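/- arXiv:2509.16821 — 9 statements merged into one kernel-verified Lean document; each statement's English description precedes it below -/
import Mathlib

section
/- Let A be a real n×n matrix, B a real n×m matrix, M a symmetric positive semidefinite n×n matrix, and R a symmetric positive definite m×m matrix. Assume the pair (A, M) is observable. Let K be an m×n matrix such that A − B·K is Hurwitz, and let P be a symmetric n×n matrix satisfying the Lyapunov equation (A − B·K)ᵀ P + P (A − B·K) = −(M + Kᵀ R K). Then the updated gain K' = R⁻¹ Bᵀ P also makes A − B·K' Hurwitz. -/
open Matrix

/-- A real square matrix is Hurwitz if every eigenvalue (over ℂ) has negative real part. -/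
def IsHurwitz {n : ℕ} (A : Matrix (Fin n) (Fin n) ℝ) : Prop :=
  ∀ μ ∈ spectrum ℂ (A.map (Complex.ofReal)), μ.re < 0

/-- The pair (A, C) is observable if the only x with C Aᵏ x = 0 for all 0 ≤ k < n is x = 0. -/
def IsObservable {n p : ℕ} (A : Matrix (Fin n) (Fin n) ℝ)
    (C : Matrix (Fin p) (Fin n) ℝ) : Prop :=
  ∀ x : Fin n → ℝ, (∀ k < n, C.mulVec ((A ^ k).mulVec x) = 0) → x = 0

open Filter Topology
open scoped ComplexOrder

/-- In a complex Banach algebra, the powers of an element whose spectrum lies in the open unit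
disc tend to zero. -/
theorem tendsto_pow_of_spectrum_norm_lt_one {𝔸 : Type*} [NormedRing 𝔸] [NormedAlgebra ℂ 𝔸]
    [CompleteSpace 𝔸] (a : 𝔸) (ha : ∀ z ∈ spectrum ℂ a, ‖z‖ < 1) :
    Tendsto (fun k : ℕ => a ^ k) atTop (𝓝 0) := by
  nontriviality 𝔸
  have hr : spectralRadius ℂ a < (1 : NNReal) :=
    spectrum.spectralRadius_lt_of_forall_lt a fun z hz => by exact_mod_cast ha z hz
  obtain ⟨r, har, hr1⟩ := ENNReal.lt_iff_exists_nnreal_btwn.mp hr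
  have hr1 : r < 1 := by exact_mod_cast hr1
  have hev : ∀ᶠ k : ℕ in atTop, ‖a ^ k‖ ≤ (r : ℝ) ^ k := by
    filter_upwards [(spectrum.pow_nnnorm_pow_one_div_tendsto_nhds_spectralRadius a).eventually
      (gt_mem_nhds har), eventually_gt_atTop 0] with k hk hk0
    have hk0' : (0 : ℝ) < k := by exact_mod_cast hk0
    have h := ENNReal.rpow_le_rpow hk.le hk0'.le
    rw [← ENNReal.rpow_mul, one_div_mul_cancel hk0'.ne', ENNReal.rpow_one,
      ENNReal.rpow_natCast] at h
    exact_mod_cast h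
  exact squeeze_zero_norm' hev (tendsto_pow_atTop_nhds_zero_of_lt_one r.coe_nonneg
    (by exact_mod_cast hr1))

namespace Matrix

variable {n : Type*} [Fintype n] [DecidableEq n]

theorem mem_spectrum_iff_exists_mulVec {K : Type*} [Field K] {A : Matrix n n K} {μ : K} :
    μ ∈ spectrum K A ↔ ∃ v ≠ 0, A *ᵥ v = μ • v := by
  rw [← spectrum_toLin', ← Module.End.hasEigenvalue_iff_mem_spectrum]
  constructor
  · intro h
    obtain ⟨v, hv⟩ := h.exists_hasEigenvector
    exact ⟨v, hv.2, by simpa using hv.apply_eq_smul⟩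
  · rintro ⟨v, hv, h⟩
    exact Module.End.hasEigenvalue_of_hasEigenvector
      (Module.End.hasEigenvector_iff.mpr ⟨Module.End.mem_eigenspace_iff.mpr (by simpa using h), hv⟩)

open scoped Norms.Operator in
theorem tendsto_pow_of_spectrum_norm_lt_one (S : Matrix n n ℂ)
    (hS : ∀ z ∈ spectrum ℂ S, ‖z‖ < 1) : Tendsto (fun k : ℕ => S ^ k) atTop (𝓝 0) :=
  have : CompleteSpace (Matrix n n ℂ) := FiniteDimensional.complete ℂ _
  _root_.tendsto_pow_of_spectrum_norm_lt_one S hS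

/-- A Hermitian solution of the Stein inequality `Sᴴ * P * S ≤ P` with `S` Schur stable is
positive semidefinite. -/
theorem PosSemidef.of_stein {S P : Matrix n n ℂ} (hS : ∀ z ∈ spectrum ℂ S, ‖z‖ < 1)
    (hP : P.IsHermitian) (h : (P - Sᴴ * P * S).PosSemidef) : P.PosSemidef := by
  have hpow (k : ℕ) : (P - (S ^ k)ᴴ * P * S ^ k).PosSemidef := by
    induction k with
    | zero => simpa using PosSemidef.zero
    | succ k ih =>
      convert! ih.add (h.conjTranspose_mul_mul_same (S ^ k)) using 1
      rw [pow_succ', conjTranspose_mul]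
      noncomm_ring
  refine .of_dotProduct_mulVec_nonneg hP fun x => ?_
  have hlim : Tendsto (fun k : ℕ => star x ⬝ᵥ ((P - (S ^ k)ᴴ * P * S ^ k) *ᵥ x)) atTop
      (𝓝 (star x ⬝ᵥ (P *ᵥ x))) := by
    have hc : Continuous fun T : Matrix n n ℂ => star x ⬝ᵥ ((P - Tᴴ * P * T) *ᵥ x) := by
      fun_prop
    simpa [Function.comp_def] using
      (hc.tendsto 0).comp (tendsto_pow_of_spectrum_norm_lt_one S hS)
  exact ge_of_tendsto' hlim fun k => (hpow k).dotProduct_mulVec_nonneg x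

/-- A Hermitian solution of a Lyapunov equation with stable coefficient and positive semidefinite
weight is positive semidefinite. The Cayley transform reduces this to the Stein inequality. -/
theorem PosSemidef.of_lyapunov {A P Q : Matrix n n ℂ} (hA : ∀ z ∈ spectrum ℂ A, z.re < 0)
    (hP : P.IsHermitian) (hQ : Q.PosSemidef) (h : Aᴴ * P + P * A = -Q) : P.PosSemidef := by
  have hN : IsUnit (A - 1) := by
    by_contra hN
    have h1 : (1 : ℂ) ∈ spectrum ℂ A := by
      rw [spectrum.mem_iff, map_one, ← neg_sub, IsUnit.neg_iff]
      exact hN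
    exact absurd (hA 1 h1) (by norm_num)
  have hdet : IsUnit (A - 1).det := (isUnit_iff_isUnit_det _).mp hN
  have hNinv : (A - 1) * (A - 1)⁻¹ = 1 := mul_nonsing_inv _ hdet
  have hNinv' : ((A - 1)⁻¹)ᴴ * (A - 1)ᴴ = 1 := by
    rw [← conjTranspose_mul, hNinv, conjTranspose_one]
  refine .of_stein (S := (A + 1) * (A - 1)⁻¹) (fun z hz => ?_) hP ?_
  · obtain ⟨v, hv, hvz⟩ := mem_spectrum_iff_exists_mulVec.mp hz
    set w := (A - 1)⁻¹ *ᵥ v with hw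
    have hvw : v = A *ᵥ w - w := by
      calc v = ((A - 1) * (A - 1)⁻¹) *ᵥ v := by rw [hNinv, one_mulVec]
        _ = A *ᵥ w - w := by rw [← mulVec_mulVec, sub_mulVec, one_mulVec]
    have hw0 : w ≠ 0 := by
      intro h0
      exact hv (by simp [hvw, h0])
    have hAw : (1 - z) • (A *ᵥ w) = -(1 + z) • w := by
      rw [← mulVec_mulVec, ← hw, add_mulVec, one_mulVec, hvw] at hvz
      rw [← sub_eq_zero] at hvz ⊢
      rw [← hvz]
      module
    have hz1 : 1 - z ≠ 0 := by
      intro h0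
      have hz1 : z = 1 := (sub_eq_zero.mp h0).symm
      rw [h0, zero_smul, eq_comm, smul_eq_zero_iff_left hw0, hz1] at hAw
      norm_num at hAw
    have hmem : -(1 + z) / (1 - z) ∈ spectrum ℂ A := by
      refine mem_spectrum_iff_exists_mulVec.mpr ⟨w, hw0, ?_⟩
      rw [div_eq_inv_mul, mul_smul, ← hAw, smul_smul, inv_mul_cancel₀ hz1, one_smul]
    have hre := hA _ hmem
    have hpos : 0 < Complex.normSq (1 - z) := Complex.normSq_pos.mpr hz1
    rw [Complex.div_re, ← add_div, div_lt_iff₀ hpos] at hre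
    simp at hre
    rw [← sq_lt_one_iff₀ (norm_nonneg z), ← Complex.normSq_eq_norm_sq, Complex.normSq_apply]
    nlinarith
  · have hQ2 : (Q + Q).PosSemidef := hQ.add hQ
    convert! hQ2.conjTranspose_mul_mul_same ((A - 1)⁻¹) using 1
    have hQA : Q + Q = (A - 1)ᴴ * P * (A - 1) - (A + 1)ᴴ * P * (A + 1) := by
      rw [← neg_neg Q, ← h]
      simp only [conjTranspose_sub, conjTranspose_add, conjTranspose_one]
      noncomm_ring
    calc P - ((A + 1) * (A - 1)⁻¹)ᴴ * P * ((A + 1) * (A - 1)⁻¹)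
        = (((A - 1)⁻¹)ᴴ * (A - 1)ᴴ) * P * ((A - 1) * (A - 1)⁻¹)
            - ((A + 1) * (A - 1)⁻¹)ᴴ * P * ((A + 1) * (A - 1)⁻¹) := by
          rw [hNinv, hNinv', one_mul, mul_one]
      _ = _ := by
          rw [hQA, conjTranspose_mul]
          noncomm_ring

theorem conjTranspose_map_ofReal {k l : Type*} (A : Matrix k l ℝ) :
    (A.map Complex.ofReal)ᴴ = Aᵀ.map Complex.ofReal := by
  ext
  simp

theorem map_mul_ofReal {k l m : Type*} [Fintype l] (A : Matrix k l ℝ) (B : Matrix l m ℝ) :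
    (A * B).map Complex.ofReal = A.map Complex.ofReal * B.map Complex.ofReal :=
  Matrix.map_mul (f := Complex.ofRealHom)

theorem PosSemidef.map_ofReal {A : Matrix n n ℝ} (hA : A.PosSemidef) :
    (A.map Complex.ofReal).PosSemidef := by
  open scoped MatrixOrder in
  obtain ⟨C, rfl⟩ := CStarAlgebra.nonneg_iff_eq_star_mul_self.mp hA.nonneg
  convert! posSemidef_conjTranspose_mul_self (C.map Complex.ofReal) using 1
  rw [conjTranspose_map_ofReal]
  exact map_mul_ofReal _ _

/-- An eigenvector of `A` in the kernel of `M` contradicts observability of `(A, M)`. -/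
theorem _root_.IsObservable.eq_zero_of_eigenvector {n p : ℕ} {A : Matrix (Fin n) (Fin n) ℝ}
    {C : Matrix (Fin p) (Fin n) ℝ} (h : IsObservable A C) {μ : ℂ} {v : Fin n → ℂ}
    (hv : A.map Complex.ofReal *ᵥ v = μ • v) (hC : C.map Complex.ofReal *ᵥ v = 0) : v = 0 := by
  have hpow (k : ℕ) : (C * A ^ k).map Complex.ofReal *ᵥ v = 0 := by
    have hk : (A ^ k).map Complex.ofReal *ᵥ v = μ ^ k • v := by
      induction k with
      | zero => simp
      | succ k ih =>
        rw [pow_succ', map_mul_ofReal, ← mulVec_mulVec, ih, mulVec_smul, hv, smul_smul, pow_succ]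
    rw [map_mul_ofReal, ← mulVec_mulVec, hk, mulVec_smul, hC, smul_zero]
  have hre : (fun i => (v i).re) = 0 := h _ fun k _ => by
    ext i
    rw [mulVec_mulVec]
    simpa [mulVec, dotProduct] using congrArg Complex.re (congrFun (hpow k) i)
  have him : (fun i => (v i).im) = 0 := h _ fun k _ => by
    ext i
    rw [mulVec_mulVec]
    simpa [mulVec, dotProduct] using congrArg Complex.im (congrFun (hpow k) i)
  ext i
  exact Complex.ext (congrFun hre i) (congrFun him i)

/-- The Lyapunov equation satisfied by `P` along the closed loop of the improved gain `L`. -/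
theorem lyapunov_policy_improvement {S : Type*} [CommRing S] {n m : Type*} [Fintype n] [Fintype m]
    {A M P : Matrix n n S} {B : Matrix n m S} {R : Matrix m m S} {K L : Matrix m n S}
    (hL : R * L = Bᵀ * P) (hL' : Lᵀ * R = P * B)
    (hLyap : (A - B * K)ᵀ * P + P * (A - B * K) = -(M + Kᵀ * R * K)) :
    (A - B * L)ᵀ * P + P * (A - B * L) = -(M + (K - L)ᵀ * R * (K - L) + Lᵀ * R * L) := by
  have hsplit : (A - B * L)ᵀ * P + P * (A - B * L) = ((A - B * K)ᵀ * P + P * (A - B * K))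
      + (K - L)ᵀ * (Bᵀ * P) + (P * B) * (K - L) := by
    simp only [transpose_sub, transpose_mul, Matrix.sub_mul, Matrix.mul_sub, Matrix.mul_assoc]
    abel
  rw [hsplit, hLyap, ← hL, ← hL']
  simp only [transpose_sub, Matrix.sub_mul, Matrix.mul_sub, Matrix.mul_assoc]
  abel

theorem dotProduct_conjTranspose_mul_mul_mulVec {k l : Type*} [Fintype k] [Fintype l]
    (T : Matrix k k ℂ) (C : Matrix k l ℂ) (v : l → ℂ) :
    star v ⬝ᵥ ((Cᴴ * T * C) *ᵥ v) = star (C *ᵥ v) ⬝ᵥ (T *ᵥ (C *ᵥ v)) := by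
  rw [Matrix.mul_assoc, ← mulVec_mulVec, ← mulVec_mulVec, dotProduct_mulVec, star_mulVec]

/-- If `v` is an eigenvector of `A` with eigenvalue `μ`, the Lyapunov form evaluates at `v` to
`2 * re μ` times the value of `P`. -/
theorem dotProduct_lyapunov_mulVec {n : Type*} [Fintype n] {A P : Matrix n n ℂ} {μ : ℂ} {v : n → ℂ}
    (hv : A *ᵥ v = μ • v) :
    star v ⬝ᵥ ((Aᴴ * P + P * A) *ᵥ v) = (2 * μ.re : ℝ) * (star v ⬝ᵥ (P *ᵥ v)) := by
  rw [add_mulVec, dotProduct_add, ← mulVec_mulVec, ← mulVec_mulVec, dotProduct_mulVec,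
    ← star_mulVec, hv, star_smul, smul_dotProduct, mulVec_smul, dotProduct_smul, smul_eq_mul,
    smul_eq_mul, ← add_mul, ← Complex.add_conj, add_comm]
  rfl

end Matrix

theorem kleinman_policy_improvement {n m : ℕ}
    (A : Matrix (Fin n) (Fin n) ℝ) (B : Matrix (Fin n) (Fin m) ℝ)
    (M : Matrix (Fin n) (Fin n) ℝ) (R : Matrix (Fin m) (Fin m) ℝ)
    (hM : M.PosSemidef) (hR : R.PosDef)
    (hObs : IsObservable A M)
    (K : Matrix (Fin m) (Fin n) ℝ) (hK : IsHurwitz (A - B * K))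
    (P : Matrix (Fin n) (Fin n) ℝ) (hPsymm : P.IsSymm)
    (hLyap : (A - B * K)ᵀ * P + P * (A - B * K) = -(M + Kᵀ * R * K)) :
    IsHurwitz (A - B * (R⁻¹ * Bᵀ * P)) := by
  have hRdet : IsUnit R.det := (isUnit_iff_isUnit_det _).mp hR.isUnit
  have hRsymm : Rᵀ = R := by simpa using hR.isHermitian.eq
  set L := R⁻¹ * Bᵀ * P with hLdef
  have hL : R * L = Bᵀ * P := by
    rw [hLdef, ← Matrix.mul_assoc, ← Matrix.mul_assoc, mul_nonsing_inv _ hRdet, Matrix.one_mul]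
  have hL' : Lᵀ * R = P * B := by
    simpa [transpose_mul, hRsymm, hPsymm.eq] using congrArg transpose hL
  have hPc : (P.map Complex.ofReal).IsHermitian := by
    rw [IsHermitian, conjTranspose_map_ofReal, hPsymm.eq]
  have hadd {k l : ℕ} (X Y : Matrix (Fin k) (Fin l) ℝ) : (X + Y).map Complex.ofReal =
      X.map Complex.ofReal + Y.map Complex.ofReal := Matrix.map_add _ Complex.ofReal_add X Y
  have hneg {k l : ℕ} (X : Matrix (Fin k) (Fin l) ℝ) : (-X).map Complex.ofReal =
      -X.map Complex.ofReal := by ext; simp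
  have hsub {k l : ℕ} (X Y : Matrix (Fin k) (Fin l) ℝ) : (X - Y).map Complex.ofReal =
      X.map Complex.ofReal - Y.map Complex.ofReal := Matrix.map_sub _ Complex.ofReal_sub X Y
  have hcongr (C : Matrix (Fin m) (Fin n) ℝ) :
      ((C.map Complex.ofReal)ᴴ * R.map Complex.ofReal * C.map Complex.ofReal).PosSemidef :=
    hR.posSemidef.map_ofReal.conjTranspose_mul_mul_same _
  have hP : (P.map Complex.ofReal).PosSemidef := by
    refine .of_lyapunov hK hPc (hM.map_ofReal.add (hcongr K)) ?_
    have h := congrArg (fun X => X.map Complex.ofReal) hLyap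
    simpa only [hadd, hneg, map_mul_ofReal, ← conjTranspose_map_ofReal] using h
  have hLyap' := congrArg (fun X => X.map Complex.ofReal) (lyapunov_policy_improvement hL hL' hLyap)
  simp only [hadd, hneg, map_mul_ofReal, ← conjTranspose_map_ofReal] at hLyap'
  intro μ hμ
  by_contra! hre
  obtain ⟨v, hv0, hv⟩ := mem_spectrum_iff_exists_mulVec.mp hμ
  have key := dotProduct_lyapunov_mulVec (P := P.map Complex.ofReal) hv
  rw [hLyap', neg_mulVec, dotProduct_neg, add_mulVec, add_mulVec, dotProduct_add,
    dotProduct_add] at key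
  have h1 := hM.map_ofReal.dotProduct_mulVec_nonneg v
  have h2 := (hcongr (K - L)).dotProduct_mulVec_nonneg v
  have h3 := (hcongr L).dotProduct_mulVec_nonneg v
  have h4 : (0 : ℂ) ≤ (2 * μ.re : ℝ) * (star v ⬝ᵥ (P.map Complex.ofReal *ᵥ v)) :=
    mul_nonneg (by exact_mod_cast mul_nonneg zero_le_two hre) (hP.dotProduct_mulVec_nonneg v)
  rw [← key, neg_nonneg] at h4
  have hsum := le_antisymm h4 (add_nonneg (add_nonneg h1 h2) h3)
  obtain ⟨h12, h3⟩ := (add_eq_zero_iff_of_nonneg (add_nonneg h1 h2) h3).mp hsum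
  have hMv := (hM.map_ofReal.dotProduct_mulVec_zero_iff v).mp
    ((add_eq_zero_iff_of_nonneg h1 h2).mp h12).1
  rw [dotProduct_conjTranspose_mul_mul_mulVec,
    hR.posSemidef.map_ofReal.dotProduct_mulVec_zero_iff] at h3
  have hLv : L.map Complex.ofReal *ᵥ v = 0 := by
    refine eq_zero_of_mulVec_eq_zero ?_ h3
    have hdet : (R.map Complex.ofReal).det = R.det := (Complex.ofRealHom.map_det R).symm
    rw [hdet]
    exact_mod_cast hRdet.ne_zero
  refine hv0 (hObs.eq_zero_of_eigenvector (μ := μ) ?_ hMv)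
  rw [hsub, map_mul_ofReal, sub_mulVec, ← mulVec_mulVec, hLv, mulVec_zero, sub_zero] at hv
  exact hv
end

section
/- Let A be a real n×n matrix, B a real n×m matrix, M a symmetric positive semidefinite n×n matrix, and R a symmetric positive definite m×m matrix, with (A, M) observable. Let K₀ make A − B·K₀ Hurwitz, and define recursively: Pᵢ is the symmetric solution of (A − B·Kᵢ)ᵀ Pᵢ + Pᵢ (A − B·Kᵢ) = −(M + Kᵢᵀ R Kᵢ), and Kᵢ₊₁ = R⁻¹ Bᵀ Pᵢ. Let P* be the symmetric positive semidefinite solution of the Riccati equation Aᵀ P* + P* A + M − P* B R⁻¹ Bᵀ P* = 0 for which A − B R⁻¹ Bᵀ P* is Hurwitz, and set K* = R⁻¹ Bᵀ P*. Then Pᵢ → P* and Kᵢ → K* as i → ∞ (entrywise convergence of matrices). -/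
open Matrix

/-- In a complex Banach algebra, powers of an element with spectrum in the open unit disc tend to
zero. -/
lemma tendsto_pow_zero_of_spectrum_norm_lt_one {𝔸 : Type*} [NormedRing 𝔸] [NormedAlgebra ℂ 𝔸]
    [CompleteSpace 𝔸] (a : 𝔸) (h : ∀ z ∈ spectrum ℂ a, ‖z‖ < 1) :
    Filter.Tendsto (fun k : ℕ => a ^ k) Filter.atTop (nhds 0) := by
  cases subsingleton_or_nontrivial 𝔸
  · exact tendsto_const_nhds.congr fun k => Subsingleton.elim _ _
  have hlt : spectralRadius ℂ a < (1 : NNReal) :=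
    spectrum.spectralRadius_lt_of_forall_lt a fun z hz => by exact_mod_cast h z hz
  obtain ⟨r, har, hr1⟩ := ENNReal.lt_iff_exists_nnreal_btwn.1 hlt
  have hr : (r : ℝ) < 1 := by exact_mod_cast hr1
  have hev := (spectrum.pow_nnnorm_pow_one_div_tendsto_nhds_spectralRadius a).eventually_lt_const har
  refine squeeze_zero_norm' ?_ (tendsto_pow_atTop_nhds_zero_of_lt_one r.coe_nonneg hr)
  filter_upwards [hev, Filter.eventually_gt_atTop 0] with k hk hk0
  have hk0' : (0 : ℝ) < k := by exact_mod_cast hk0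
  rw [one_div, ENNReal.rpow_inv_lt_iff hk0', ENNReal.rpow_natCast] at hk
  exact_mod_cast hk.le

lemma Matrix.mem_spectrum_iff_exists_mulVec_s2 {n : ℕ} (A : Matrix (Fin n) (Fin n) ℂ) (μ : ℂ) :
    μ ∈ spectrum ℂ A ↔ ∃ v ≠ 0, A *ᵥ v = μ • v := by
  rw [← Matrix.spectrum_toLin', ← Module.End.hasEigenvalue_iff_mem_spectrum]
  constructor
  · intro h
    obtain ⟨v, hv⟩ := h.exists_hasEigenvector
    exact ⟨v, hv.2, by simpa using hv.apply_eq_smul⟩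
  · rintro ⟨v, hv, h⟩
    exact Module.End.hasEigenvalue_of_hasEigenvector
      ⟨Module.End.mem_eigenspace_iff.2 (by simpa using h), hv⟩

/-- A complex eigenvector of a real matrix, split into real and imaginary parts. -/
lemma exists_re_im_of_not_isHurwitz {n : ℕ} {F : Matrix (Fin n) (Fin n) ℝ} (h : ¬ IsHurwitz F) :
    ∃ (a b : ℝ) (x y : Fin n → ℝ), 0 ≤ a ∧ (x ≠ 0 ∨ y ≠ 0) ∧
      F *ᵥ x = a • x - b • y ∧ F *ᵥ y = b • x + a • y := by
  simp only [IsHurwitz, not_forall, not_lt] at h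
  obtain ⟨μ, hμ, hre⟩ := h
  obtain ⟨v, hv, hFv⟩ := (Matrix.mem_spectrum_iff_exists_mulVec_s2 _ _).1 hμ
  refine ⟨μ.re, μ.im, fun i => (v i).re, fun i => (v i).im, hre, ?_, ?_, ?_⟩
  · by_contra! h0
    exact hv (funext fun i => Complex.ext (congrFun h0.1 i) (congrFun h0.2 i))
  · funext i
    have := congrArg Complex.re (congrFun hFv i)
    simpa [Matrix.mulVec, dotProduct] using this
  · funext i
    have := congrArg Complex.im (congrFun hFv i)
    simpa [Matrix.mulVec, dotProduct, add_comm] using this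

lemma Matrix.IsSymm.dotProduct_mulVec_comm {n : ℕ} {X : Matrix (Fin n) (Fin n) ℝ} (hX : X.IsSymm)
    (x y : Fin n → ℝ) : x ⬝ᵥ X *ᵥ y = y ⬝ᵥ X *ᵥ x := by
  rw [Matrix.dotProduct_mulVec, ← Matrix.mulVec_transpose, hX.eq, dotProduct_comm]

lemma Matrix.PosSemidef.isSymm {n : ℕ} {X : Matrix (Fin n) (Fin n) ℝ} (hX : X.PosSemidef) :
    X.IsSymm := by
  simpa [Matrix.IsHermitian, Matrix.IsSymm] using hX.isHermitian

lemma Matrix.PosSemidef.quadratic_nonneg {n : ℕ} {X : Matrix (Fin n) (Fin n) ℝ}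
    (hX : X.PosSemidef) (x : Fin n → ℝ) : 0 ≤ x ⬝ᵥ X *ᵥ x := by
  simpa using hX.dotProduct_mulVec_nonneg x

lemma Matrix.IsSymm.posSemidef {n : ℕ} {X : Matrix (Fin n) (Fin n) ℝ} (hX : X.IsSymm)
    (h : ∀ x, 0 ≤ x ⬝ᵥ X *ᵥ x) : X.PosSemidef :=
  .of_dotProduct_mulVec_nonneg (by simpa [Matrix.IsHermitian, Matrix.IsSymm] using hX)
    (by simpa using h)

lemma lyapunov_quadratic {n : ℕ} {F X Q : Matrix (Fin n) (Fin n) ℝ} (hX : X.IsSymm)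
    (h : Fᵀ * X + X * F = -Q) (x : Fin n → ℝ) :
    2 * (x ⬝ᵥ X *ᵥ (F *ᵥ x)) = -(x ⬝ᵥ Q *ᵥ x) := by
  rw [← dotProduct_neg, ← Matrix.neg_mulVec, ← h, Matrix.add_mulVec, dotProduct_add,
    ← Matrix.mulVec_mulVec, ← Matrix.mulVec_mulVec, Matrix.dotProduct_mulVec x Fᵀ,
    Matrix.vecMul_transpose, hX.dotProduct_mulVec_comm (F *ᵥ x) x]
  ring

/-- A Lyapunov certificate together with an observability condition forces stability. -/
lemma isHurwitz_of_lyapunov {n : ℕ} {A F M X Q : Matrix (Fin n) (Fin n) ℝ}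
    (hObs : IsObservable A M) (hX : X.PosSemidef) (hQ : Q.PosSemidef)
    (h : Fᵀ * X + X * F = -Q)
    (hker : ∀ x, x ⬝ᵥ Q *ᵥ x = 0 → M *ᵥ x = 0 ∧ A *ᵥ x = F *ᵥ x) : IsHurwitz F := by
  by_contra hF
  obtain ⟨a, b, x, y, ha, hxy, hFx, hFy⟩ := exists_re_im_of_not_isHurwitz hF
  have hx := lyapunov_quadratic hX.isSymm h x
  have hy := lyapunov_quadratic hX.isSymm h y
  rw [hFx, Matrix.mulVec_sub, Matrix.mulVec_smul, Matrix.mulVec_smul, dotProduct_sub,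
    dotProduct_smul, dotProduct_smul, smul_eq_mul, smul_eq_mul] at hx
  rw [hFy, Matrix.mulVec_add, Matrix.mulVec_smul, Matrix.mulVec_smul, dotProduct_add,
    dotProduct_smul, dotProduct_smul, smul_eq_mul, smul_eq_mul,
    hX.isSymm.dotProduct_mulVec_comm y x] at hy
  have hXx := mul_nonneg ha (hX.quadratic_nonneg x)
  have hXy := mul_nonneg ha (hX.quadratic_nonneg y)
  have hQx := hQ.quadratic_nonneg x
  have hQy := hQ.quadratic_nonneg y
  obtain ⟨hMx, hAx⟩ := hker x (by linarith)
  obtain ⟨hMy, hAy⟩ := hker y (by linarith)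
  have key : ∀ k, M *ᵥ (A ^ k *ᵥ x) = 0 ∧ M *ᵥ (A ^ k *ᵥ y) = 0 := by
    intro k
    induction k with
    | zero => simp [hMx, hMy]
    | succ k ih =>
      rw [pow_succ, ← Matrix.mulVec_mulVec, ← Matrix.mulVec_mulVec, hAx, hAy, hFx, hFy]
      simp [Matrix.mulVec_sub, Matrix.mulVec_add, Matrix.mulVec_smul, ih]
  rcases hxy with hx0 | hy0
  · exact hx0 (hObs x fun k _ => (key k).1)
  · exact hy0 (hObs y fun k _ => (key k).2)

lemma IsHurwitz.det_one_sub_ne_zero {n : ℕ} {F : Matrix (Fin n) (Fin n) ℝ} (hF : IsHurwitz F) :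
    (1 - F).det ≠ 0 := by
  intro h
  have hdet : (1 - F.map Complex.ofReal).det = 0 := by
    have := Complex.ofRealHom.map_det (1 - F)
    rw [h, map_sub, map_one, map_zero] at this
    exact this.symm
  obtain ⟨v, hv, hFv⟩ := Matrix.exists_mulVec_eq_zero_iff.2 hdet
  rw [Matrix.sub_mulVec, Matrix.one_mulVec, sub_eq_zero] at hFv
  have := hF 1 ((Matrix.mem_spectrum_iff_exists_mulVec_s2 _ _).2 ⟨v, hv, by rw [one_smul, ← hFv]⟩)
  norm_num at this

/-- The Cayley transform of a Hurwitz matrix has powers tending to zero. -/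
lemma IsHurwitz.tendsto_cayley_pow {n : ℕ} {F G : Matrix (Fin n) (Fin n) ℝ} (hF : IsHurwitz F)
    (hG : G * (1 - F) = 1 + F) :
    Filter.Tendsto (fun k : ℕ => G ^ k) Filter.atTop (nhds 0) := by
  let _ : NormedRing (Matrix (Fin n) (Fin n) ℂ) := Matrix.linftyOpNormedRing
  let _ : NormedAlgebra ℂ (Matrix (Fin n) (Fin n) ℂ) := Matrix.linftyOpNormedAlgebra
  have hGc : G.map Complex.ofReal * (1 - F.map Complex.ofReal) = 1 + F.map Complex.ofReal := by
    have := congrArg Complex.ofRealHom.mapMatrix hG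
    rw [map_mul, map_sub, map_add, map_one] at this
    exact this
  have hunit : IsUnit (1 - F.map Complex.ofReal) := by
    have := ((Matrix.isUnit_iff_isUnit_det _).2 hF.det_one_sub_ne_zero.isUnit).map
      (Complex.ofRealHom.mapMatrix (m := Fin n))
    rw [map_sub, map_one] at this
    exact this
  have hspec : ∀ g ∈ spectrum ℂ (G.map Complex.ofReal), ‖g‖ < 1 := by
    intro g hg
    obtain ⟨w, hw, hGw⟩ := (Matrix.mem_spectrum_iff_exists_mulVec_s2 _ _).1 hg
    obtain ⟨v, rfl⟩ := Matrix.mulVec_surjective_iff_isUnit.2 hunit w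
    have hv : v ≠ 0 := by rintro rfl; simp at hw
    rw [Matrix.mulVec_mulVec, hGc, Matrix.add_mulVec, Matrix.sub_mulVec, Matrix.one_mulVec] at hGw
    have hFv : (g + 1) • (F.map Complex.ofReal *ᵥ v) = (g - 1) • v := by
      rw [smul_sub] at hGw
      rw [add_smul, sub_smul, one_smul, one_smul]
      linear_combination hGw
    have hg1 : g + 1 ≠ 0 := by
      intro h0
      rw [h0, zero_smul, eq_comm, smul_eq_zero] at hFv
      rcases hFv with h1 | h1
      · have : (2 : ℂ) = 0 := by linear_combination h0 - h1
        norm_num at this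
      · exact hv h1
    have hre := hF ((g + 1)⁻¹ * (g - 1)) ((Matrix.mem_spectrum_iff_exists_mulVec_s2 _ _).2
      ⟨v, hv, by rw [mul_smul, ← hFv, inv_smul_smul₀ hg1]⟩)
    have hpos : 0 < Complex.normSq (g + 1) := Complex.normSq_pos.2 hg1
    have hnum : ((g + 1)⁻¹ * (g - 1)).re = (Complex.normSq g - 1) / Complex.normSq (g + 1) := by
      rw [Complex.mul_re, Complex.inv_re, Complex.inv_im]
      field_simp
      simp [Complex.normSq_apply]
      ring
    rw [hnum, div_neg_iff] at hre
    have : Complex.normSq g < 1 := by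
      rcases hre with h | h <;> linarith [h.1, h.2]
    rw [Complex.normSq_eq_norm_sq] at this
    exact (sq_lt_one_iff₀ (norm_nonneg g)).1 this
  have hlim := tendsto_pow_zero_of_spectrum_norm_lt_one _ hspec
  have hre := ((continuous_id.matrix_map Complex.continuous_re).tendsto
    (0 : Matrix (Fin n) (Fin n) ℂ)).comp hlim
  convert! hre using 1
  · funext k
    have : (G ^ k).map Complex.ofReal = G.map Complex.ofReal ^ k :=
      map_pow (Complex.ofRealHom.mapMatrix (m := Fin n)) G k
    ext i j
    simp [← this]

/-- Solutions of the Lyapunov equation of a Hurwitz matrix inherit semidefiniteness. -/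
lemma IsHurwitz.posSemidef_of_lyapunov {n : ℕ} {F X Q : Matrix (Fin n) (Fin n) ℝ}
    (hF : IsHurwitz F) (hX : X.IsSymm) (hQ : Q.PosSemidef) (h : Fᵀ * X + X * F = -Q) :
    X.PosSemidef := by
  have hu := (Matrix.isUnit_iff_isUnit_det _).2 hF.det_one_sub_ne_zero.isUnit
  set G := (1 + F) * (1 - F)⁻¹
  have hG : G * (1 - F) = 1 + F :=
    Matrix.nonsing_inv_mul_cancel_right _ _ hF.det_one_sub_ne_zero.isUnit
  have hstep : ∀ u, (G *ᵥ u) ⬝ᵥ X *ᵥ (G *ᵥ u) ≤ u ⬝ᵥ X *ᵥ u := by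
    intro u
    obtain ⟨v, rfl⟩ := Matrix.mulVec_surjective_iff_isUnit.2 hu u
    have hv := lyapunov_quadratic hX h v
    have hQv := hQ.quadratic_nonneg v
    rw [Matrix.mulVec_mulVec, hG]
    simp only [Matrix.add_mulVec, Matrix.sub_mulVec, Matrix.one_mulVec, Matrix.mulVec_add,
      Matrix.mulVec_sub, dotProduct_add, dotProduct_sub, add_dotProduct, sub_dotProduct]
    rw [hX.dotProduct_mulVec_comm (F *ᵥ v) v]
    linarith
  refine hX.posSemidef fun u => ?_
  have hle : ∀ k : ℕ, (G ^ k *ᵥ u) ⬝ᵥ X *ᵥ (G ^ k *ᵥ u) ≤ u ⬝ᵥ X *ᵥ u := by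
    intro k
    induction k with
    | zero => simp
    | succ k ih =>
      rw [pow_succ', ← Matrix.mulVec_mulVec]
      exact (hstep _).trans ih
  have hcont : Continuous fun Y : Matrix (Fin n) (Fin n) ℝ => (Y *ᵥ u) ⬝ᵥ X *ᵥ (Y *ᵥ u) := by
    fun_prop
  have hlim := (hcont.tendsto 0).comp (hF.tendsto_cayley_pow hG)
  simp only [Matrix.zero_mulVec, zero_dotProduct] at hlim
  exact le_of_tendsto' hlim hle

lemma Matrix.IsSymm.apply_eq_quadratic {n : ℕ} {X : Matrix (Fin n) (Fin n) ℝ} (hX : X.IsSymm)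
    (i j : Fin n) :
    X i j = ((Pi.single i 1 + Pi.single j 1) ⬝ᵥ X *ᵥ (Pi.single i 1 + Pi.single j 1)
      - Pi.single i 1 ⬝ᵥ X *ᵥ Pi.single i 1 - Pi.single j 1 ⬝ᵥ X *ᵥ Pi.single j 1) / 2 := by
  have := hX.apply i j
  simp [Matrix.mulVec_add, add_dotProduct, dotProduct_add]
  linarith

/-- A decreasing sequence of symmetric matrices that is bounded below converges. -/
lemma exists_tendsto_of_antitone_posSemidef {n : ℕ} {P : ℕ → Matrix (Fin n) (Fin n) ℝ}
    {L : Matrix (Fin n) (Fin n) ℝ} (hsymm : ∀ i, (P i).IsSymm)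
    (hanti : ∀ i, (P i - P (i + 1)).PosSemidef) (hbdd : ∀ i, (P i - L).PosSemidef) :
    ∃ Q, Filter.Tendsto P Filter.atTop (nhds Q) := by
  have hq : ∀ x : Fin n → ℝ,
      ∃ l, Filter.Tendsto (fun k => x ⬝ᵥ P k *ᵥ x) Filter.atTop (nhds l) := by
    intro x
    refine ⟨_, tendsto_atTop_ciInf (antitone_nat_of_succ_le fun k => ?_) ⟨x ⬝ᵥ L *ᵥ x, ?_⟩⟩
    · have := (hanti k).quadratic_nonneg x
      rwa [Matrix.sub_mulVec, dotProduct_sub, sub_nonneg] at this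
    · rintro _ ⟨k, rfl⟩
      have := (hbdd k).quadratic_nonneg x
      rwa [Matrix.sub_mulVec, dotProduct_sub, sub_nonneg] at this
  choose q hq using hq
  refine ⟨Matrix.of fun i j => (q (Pi.single i 1 + Pi.single j 1) - q (Pi.single i 1)
    - q (Pi.single j 1)) / 2, tendsto_pi_nhds.2 fun i => tendsto_pi_nhds.2 fun j => ?_⟩
  exact ((((hq _).sub (hq _)).sub (hq _)).div_const 2).congr fun k =>
    ((hsymm k).apply_eq_quadratic i j).symm

lemma Matrix.PosDef.transpose_mul_mul_posSemidef {n m : ℕ} {R : Matrix (Fin m) (Fin m) ℝ}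
    (hR : R.PosDef) (L : Matrix (Fin m) (Fin n) ℝ) : (Lᵀ * R * L).PosSemidef := by
  simpa using hR.posSemidef.conjTranspose_mul_mul_same L

/-- If the Lyapunov equation of the closed loop `A - B * K` with the right-hand side dominating the
running cost has a semidefinite solution, then `A - B * K` is Hurwitz. -/
lemma isHurwitz_closedLoop_of_lyapunov {n m : ℕ} {A M X Q : Matrix (Fin n) (Fin n) ℝ}
    {B : Matrix (Fin n) (Fin m) ℝ} {R : Matrix (Fin m) (Fin m) ℝ} {K : Matrix (Fin m) (Fin n) ℝ}
    (hObs : IsObservable A M) (hM : M.PosSemidef) (hR : R.PosDef) (hX : X.PosSemidef)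
    (hQ : Q.PosSemidef)
    (h : (A - B * K)ᵀ * X + X * (A - B * K) = -(M + Kᵀ * R * K + Q)) :
    IsHurwitz (A - B * K) := by
  have hK := hR.transpose_mul_mul_posSemidef K
  refine isHurwitz_of_lyapunov hObs hX ((hM.add hK).add hQ) h fun x hx => ?_
  have hx1 := hM.quadratic_nonneg x
  have hx2 := hK.quadratic_nonneg x
  have hx3 := hQ.quadratic_nonneg x
  rw [Matrix.add_mulVec, Matrix.add_mulVec, dotProduct_add, dotProduct_add] at hx
  have hKx : K *ᵥ x = 0 := by
    by_contra hne
    have hpos := hR.dotProduct_mulVec_pos hne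
    have : x ⬝ᵥ (Kᵀ * R * K) *ᵥ x = (K *ᵥ x) ⬝ᵥ R *ᵥ (K *ᵥ x) := by
      rw [← Matrix.mulVec_mulVec, ← Matrix.mulVec_mulVec, Matrix.dotProduct_mulVec x,
        Matrix.vecMul_transpose]
    simp only [star_trivial] at hpos
    linarith
  refine ⟨?_, by rw [Matrix.sub_mulVec, ← Matrix.mulVec_mulVec, hKx]; simp⟩
  exact (hM.dotProduct_mulVec_zero_iff x).1 (by simp only [star_trivial]; linarith)

/-- Completing the square in the closed-loop Lyapunov operator. -/
lemma lyapunov_completeSquare {n m : ℕ} {A X : Matrix (Fin n) (Fin n) ℝ}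
    {B : Matrix (Fin n) (Fin m) ℝ} {R : Matrix (Fin m) (Fin m) ℝ}
    {L : Matrix (Fin m) (Fin n) ℝ} (hR : R.PosDef) (hX : X.IsSymm) (hL : L = R⁻¹ * Bᵀ * X)
    (K : Matrix (Fin m) (Fin n) ℝ) :
    (A - B * K)ᵀ * X + X * (A - B * K) =
      Aᵀ * X + X * A - Lᵀ * R * L - Kᵀ * R * K + (K - L)ᵀ * R * (K - L) := by
  have hBX : Bᵀ * X = R * L := by
    rw [hL, Matrix.mul_assoc, Matrix.mul_nonsing_inv_cancel_left _ _
      ((Matrix.isUnit_iff_isUnit_det _).1 hR.isUnit)]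
  have hXB : X * B = Lᵀ * R := by
    have := congrArg Matrix.transpose hBX
    rwa [Matrix.transpose_mul, Matrix.transpose_mul R, Matrix.transpose_transpose, hX.eq,
      hR.posSemidef.isSymm.eq] at this
  simp only [Matrix.transpose_sub, Matrix.transpose_mul, Matrix.sub_mul, Matrix.mul_sub,
    Matrix.mul_assoc, hBX]
  simp only [← Matrix.mul_assoc, hXB]
  abel

/-- Changing the feedback in the equation of policy evaluation, for a policy `K` with cost `X` and
improved policy `L`. -/
lemma lyapunov_change_feedback {n m : ℕ} {A X M : Matrix (Fin n) (Fin n) ℝ}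
    {B : Matrix (Fin n) (Fin m) ℝ} {R : Matrix (Fin m) (Fin m) ℝ}
    {K L : Matrix (Fin m) (Fin n) ℝ} (hR : R.PosDef) (hX : X.IsSymm) (hL : L = R⁻¹ * Bᵀ * X)
    (h : (A - B * K)ᵀ * X + X * (A - B * K) = -(M + Kᵀ * R * K))
    (K' : Matrix (Fin m) (Fin n) ℝ) :
    (A - B * K')ᵀ * X + X * (A - B * K') =
      -(M + K'ᵀ * R * K' + (K - L)ᵀ * R * (K - L)) + (K' - L)ᵀ * R * (K' - L) := by
  have h1 := lyapunov_completeSquare (A := A) hR hX hL K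
  rw [h, ← sub_eq_iff_eq_add, eq_sub_iff_add_eq] at h1
  rw [lyapunov_completeSquare hR hX hL K', ← h1]
  abel

/-- A symmetric solution of the Riccati equation satisfies the Lyapunov equation of its own
closed loop. -/
lemma lyapunov_of_riccati {n m : ℕ} {A X M : Matrix (Fin n) (Fin n) ℝ}
    {B : Matrix (Fin n) (Fin m) ℝ} {R : Matrix (Fin m) (Fin m) ℝ}
    (hR : R.PosDef) (hX : X.IsSymm)
    (h : Aᵀ * X + X * A + M - X * B * R⁻¹ * Bᵀ * X = 0) :
    (A - B * (R⁻¹ * Bᵀ * X))ᵀ * X + X * (A - B * (R⁻¹ * Bᵀ * X)) =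
      -(M + (R⁻¹ * Bᵀ * X)ᵀ * R * (R⁻¹ * Bᵀ * X)) := by
  have hL : (R⁻¹ * Bᵀ * X)ᵀ * R * (R⁻¹ * Bᵀ * X) = X * B * R⁻¹ * Bᵀ * X := by
    have hdet := (Matrix.isUnit_iff_isUnit_det _).1 hR.isUnit
    rw [Matrix.transpose_mul, Matrix.transpose_mul, Matrix.transpose_transpose, hX.eq,
      Matrix.transpose_nonsing_inv, hR.posSemidef.isSymm.eq]
    simp only [Matrix.mul_assoc, Matrix.mul_nonsing_inv_cancel_left _ _ hdet]
  rw [lyapunov_completeSquare hR hX rfl, sub_self, Matrix.mul_zero, add_zero, hL,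
    eq_neg_iff_add_eq_zero, ← h]
  abel

/-- Comparison of the solutions of two Lyapunov equations for the same Hurwitz matrix. -/
lemma IsHurwitz.posSemidef_sub_of_lyapunov {n : ℕ} {F X Y Q S T : Matrix (Fin n) (Fin n) ℝ}
    (hF : IsHurwitz F) (hX : X.IsSymm) (hY : Y.IsSymm) (hQ : Q.PosSemidef)
    (h₁ : Fᵀ * X + X * F = S) (h₂ : Fᵀ * Y + Y * F = T) (h : T = S + Q) :
    (X - Y).PosSemidef := by
  refine hF.posSemidef_of_lyapunov (hX.sub hY) hQ ?_
  calc _ = (Fᵀ * X + X * F) - (Fᵀ * Y + Y * F) := by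
        rw [Matrix.mul_sub, Matrix.sub_mul]; abel
    _ = _ := by rw [h₁, h₂, h]; abel

theorem kleinman_convergence {n m : ℕ}
    (A : Matrix (Fin n) (Fin n) ℝ) (B : Matrix (Fin n) (Fin m) ℝ)
    (M : Matrix (Fin n) (Fin n) ℝ) (R : Matrix (Fin m) (Fin m) ℝ)
    (hM : M.PosSemidef) (hR : R.PosDef)
    (hObs : IsObservable A M)
    (K : ℕ → Matrix (Fin m) (Fin n) ℝ) (P : ℕ → Matrix (Fin n) (Fin n) ℝ)
    (hK0 : IsHurwitz (A - B * K 0))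
    (hPsymm : ∀ i, (P i).IsSymm)
    (hLyap : ∀ i, (A - B * K i)ᵀ * P i + P i * (A - B * K i) = -(M + (K i)ᵀ * R * K i))
    (hKupd : ∀ i, K (i + 1) = R⁻¹ * Bᵀ * P i)
    (Pstar : Matrix (Fin n) (Fin n) ℝ) (hPstar : Pstar.PosSemidef)
    (hRiccati : Aᵀ * Pstar + Pstar * A + M - Pstar * B * R⁻¹ * Bᵀ * Pstar = 0)
    (hStab : IsHurwitz (A - B * (R⁻¹ * Bᵀ * Pstar)))
    (Kstar : Matrix (Fin m) (Fin n) ℝ) (hKstar : Kstar = R⁻¹ * Bᵀ * Pstar) :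
    (∀ i j, Filter.Tendsto (fun k => P k i j) Filter.atTop (nhds (Pstar i j))) ∧
      (∀ i j, Filter.Tendsto (fun k => K k i j) Filter.atTop (nhds (Kstar i j))) := by
  have hPs := hPstar.isSymm
  have hsq := fun L : Matrix (Fin m) (Fin n) ℝ => hR.transpose_mul_mul_posSemidef L
  have hLstar := lyapunov_of_riccati hR hPs hRiccati
  rw [← hKstar] at hStab hLstar
  have hnext : ∀ i, (A - B * K (i + 1))ᵀ * P i + P i * (A - B * K (i + 1)) =
      -(M + (K (i + 1))ᵀ * R * K (i + 1) + (K i - K (i + 1))ᵀ * R * (K i - K (i + 1))) :=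
    fun i => by
      simpa using lyapunov_change_feedback hR (hPsymm i) (hKupd i) (hLyap i) (K (i + 1))
  have hHur : ∀ i, IsHurwitz (A - B * K i) := by
    intro i
    induction i with
    | zero => exact hK0
    | succ i ih =>
      have hPi := ih.posSemidef_of_lyapunov (hPsymm i) (hM.add (hsq (K i))) (hLyap i)
      exact isHurwitz_closedLoop_of_lyapunov hObs hM hR hPi (hsq _) (hnext i)
  have hanti : ∀ i, (P i - P (i + 1)).PosSemidef := fun i =>
    (hHur (i + 1)).posSemidef_sub_of_lyapunov (hPsymm i) (hPsymm (i + 1))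
      (hsq (K i - K (i + 1))) (hnext i) (hLyap (i + 1)) (by abel)
  have hbdd : ∀ i, (P i - Pstar).PosSemidef := fun i =>
    (hHur i).posSemidef_sub_of_lyapunov (hPsymm i) hPs (hsq (K i - Kstar)) (hLyap i)
      (lyapunov_change_feedback hR hPs hKstar hLstar (K i)) (by simp)
  obtain ⟨Q, hQ⟩ := exists_tendsto_of_antitone_posSemidef hPsymm hanti hbdd
  have hKlim : Filter.Tendsto K Filter.atTop (nhds (R⁻¹ * Bᵀ * Q)) := by
    rw [← Filter.tendsto_add_atTop_iff_nat 1]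
    simp only [hKupd]
    have hc : Continuous fun X : Matrix (Fin n) (Fin n) ℝ => R⁻¹ * Bᵀ * X := by fun_prop
    exact (hc.tendsto Q).comp hQ
  have hQs : Q.IsSymm := by
    have hc : Continuous fun X : Matrix (Fin n) (Fin n) ℝ => Xᵀ := by fun_prop
    exact tendsto_nhds_unique ((hc.tendsto Q).comp hQ) (hQ.congr fun i => (hPsymm i).eq.symm)
  have hQlyap : (A - B * (R⁻¹ * Bᵀ * Q))ᵀ * Q + Q * (A - B * (R⁻¹ * Bᵀ * Q)) =
      -(M + (R⁻¹ * Bᵀ * Q)ᵀ * R * (R⁻¹ * Bᵀ * Q)) := by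
    have hc : Continuous fun p : Matrix (Fin n) (Fin n) ℝ × Matrix (Fin m) (Fin n) ℝ =>
        (A - B * p.2)ᵀ * p.1 + p.1 * (A - B * p.2) + (M + p.2ᵀ * R * p.2) := by fun_prop
    have hlim := (hc.tendsto (Q, R⁻¹ * Bᵀ * Q)).comp (hQ.prodMk_nhds hKlim)
    rw [← add_eq_zero_iff_eq_neg]
    refine tendsto_nhds_unique hlim (tendsto_const_nhds.congr fun i => ?_)
    rw [Function.comp_apply, hLyap i, neg_add_cancel]
  have hQle : (Pstar - Q).PosSemidef :=
    hStab.posSemidef_sub_of_lyapunov hPs hQs (hsq (Kstar - R⁻¹ * Bᵀ * Q)) hLstar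
      (lyapunov_change_feedback hR hQs rfl hQlyap Kstar) (by simp)
  have hquad : ∀ x : Fin n → ℝ, x ⬝ᵥ Q *ᵥ x = x ⬝ᵥ Pstar *ᵥ x := fun x => by
    have h1 := hQle.quadratic_nonneg x
    rw [Matrix.sub_mulVec, dotProduct_sub, sub_nonneg] at h1
    have hc : Continuous fun X : Matrix (Fin n) (Fin n) ℝ => x ⬝ᵥ X *ᵥ x := by fun_prop
    refine h1.antisymm (ge_of_tendsto' ((hc.tendsto Q).comp hQ) fun i => ?_)
    have h2 := (hbdd i).quadratic_nonneg x
    rwa [Matrix.sub_mulVec, dotProduct_sub, sub_nonneg] at h2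
  have hQP : Q = Pstar := by
    ext i j
    rw [hQs.apply_eq_quadratic, hPs.apply_eq_quadratic, hquad, hquad, hquad]
  rw [hQP] at hQ hKlim
  rw [← hKstar] at hKlim
  refine ⟨fun i j => ?_, fun i j => ?_⟩
  · have hc : Continuous fun X : Matrix (Fin n) (Fin n) ℝ => X i j := by fun_prop
    exact (hc.tendsto Pstar).comp hQ
  · have hc : Continuous fun X : Matrix (Fin m) (Fin n) ℝ => X i j := by fun_prop
    exact (hc.tendsto Kstar).comp hKlim
end

section
/- Let A be a real n×n matrix and B a real n×m matrix such that the pair (A, B) is stabilizable, i.e., there exists an m×n matrix K with A − B·K Hurwitz. Then there exist a symmetric positive definite n×n matrix S and a real number ϖ > 0 such that S Aᵀ + A S − ϖ B Bᵀ is negative definite. -/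
open Matrix

open Filter Topology

open scoped MatrixOrder Matrix.Norms.L2Operator

/-- In a complex Banach algebra, the powers of an element whose spectrum lies in the open unit disc
tend to zero. -/
theorem tendsto_pow_zero_of_forall_spectrum_norm_lt_one {E : Type*} [NormedRing E]
    [NormedAlgebra ℂ E] [CompleteSpace E] {a : E} (ha : ∀ z ∈ spectrum ℂ a, ‖z‖ < 1) :
    Tendsto (fun k : ℕ => a ^ k) atTop (𝓝 0) := by
  nontriviality E
  have hr : spectralRadius ℂ a < (1 : NNReal) :=
    spectrum.spectralRadius_lt_of_forall_lt a fun z hz => mod_cast ha z hz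
  obtain ⟨r, hr, hr1⟩ := ENNReal.lt_iff_exists_nnreal_btwn.mp hr
  have hev := (spectrum.pow_nnnorm_pow_one_div_tendsto_nhds_spectralRadius a).eventually_lt_const hr
  refine squeeze_zero_norm' ?_ (tendsto_pow_atTop_nhds_zero_of_lt_one r.2 (mod_cast hr1))
  filter_upwards [hev, eventually_gt_atTop 0] with k hk hk0
  have hk' : (0 : ℝ) < k := mod_cast hk0
  have h := ENNReal.rpow_lt_rpow hk hk'
  rw [← ENNReal.rpow_mul, one_div_mul_cancel hk'.ne', ENNReal.rpow_one, ENNReal.rpow_natCast] at h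
  exact_mod_cast h.le

namespace Matrix

variable {n : Type*} [Fintype n] [DecidableEq n]

theorem tendsto_pow_zero_of_spectrum_map_ofReal {M : Matrix n n ℝ}
    (hM : ∀ z ∈ spectrum ℂ (M.map Complex.ofReal), ‖z‖ < 1) :
    Tendsto (fun k : ℕ => M ^ k) atTop (𝓝 0) := by
  have h := tendsto_pow_zero_of_forall_spectrum_norm_lt_one hM
  have hre : Continuous fun X : Matrix n n ℂ => X.map Complex.re :=
    continuous_id.matrix_map Complex.continuous_re
  have h2 := (hre.tendsto 0).comp h
  convert h2 using 2 with k
  · have : M.map Complex.ofReal ^ k = (M ^ k).map Complex.ofReal :=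
      (map_pow (Complex.ofRealHom.mapMatrix) M k).symm
    ext i j
    simp [this]
  · ext i j
    simp

theorem IsHermitian.posDef_one_sub_of_norm_lt_one {X : Matrix n n ℝ} (hX : X.IsHermitian)
    (h : ‖X‖ < 1) : (1 - X).PosDef := by
  have hH : IsSelfAdjoint (1 - X) := (isHermitian_one.sub hX).isSelfAdjoint
  rw [← isStrictlyPositive_iff_posDef,
    StarOrderedRing.isStrictlyPositive_iff_spectrum_pos (R := ℝ) _ hH]
  intro t ht
  cases isEmpty_or_nonempty n
  · simp [spectrum.of_subsingleton] at ht
  have ht' : 1 - t ∈ spectrum ℝ X := by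
    rw [spectrum.mem_iff] at ht ⊢
    rwa [← IsUnit.neg_iff, map_sub, map_one,
      show -(1 - algebraMap ℝ (Matrix n n ℝ) t - X) =
        algebraMap ℝ (Matrix n n ℝ) t - (1 - X) by abel]
  have := (spectrum.norm_le_norm_of_mem ht').trans_lt h
  rw [Real.norm_eq_abs, abs_lt] at this
  linarith

/-- Positive definiteness is stable under small Hermitian perturbations. -/
theorem PosDef.eventually_sub_smul {Q H : Matrix n n ℝ} (hQ : Q.PosDef) (hH : H.IsHermitian) :
    ∀ᶠ t : ℝ in 𝓝 0, (Q - t • H).PosDef := by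
  obtain ⟨C, hC, rfl⟩ : ∃ C : Matrix n n ℝ, IsUnit C ∧ Q = Cᴴ * C := by
    obtain ⟨C, rfl⟩ := CStarAlgebra.nonneg_iff_eq_star_mul_self.mp hQ.posSemidef.nonneg
    refine ⟨C, ?_, rfl⟩
    exact isUnit_of_mul_isUnit_right hQ.isUnit
  have hdet := (isUnit_iff_isUnit_det C).mp hC
  have hdet' : IsUnit Cᴴ.det := by rw [det_conjTranspose]; exact hdet.star
  set Z := (C⁻¹)ᴴ * H * C⁻¹ with hZ
  have hcont : Tendsto (fun t : ℝ => ‖t • Z‖) (𝓝 0) (𝓝 0) := by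
    have : Continuous fun t : ℝ => ‖t • Z‖ := by fun_prop
    simpa using this.tendsto 0
  filter_upwards [hcont.eventually_lt_const one_pos] with t ht
  have hZH : (t • Z).IsHermitian :=
    (isHermitian_conjTranspose_mul_mul _ hH).smul (IsSelfAdjoint.all t)
  have h := (hZH.posDef_one_sub_of_norm_lt_one ht).conjTranspose_mul_mul_same
    (mulVec_injective_iff_isUnit.mpr hC)
  convert h using 1
  have : Cᴴ * Z * C = H := by
    rw [hZ, conjTranspose_nonsing_inv, mul_assoc, nonsing_inv_mul_cancel_right _ _ hdet,
      mul_nonsing_inv_cancel_left _ _ hdet']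
  rw [mul_sub, sub_mul, mul_one, mul_smul_comm, smul_mul_assoc, this]

/-- Discrete Lyapunov theorem. -/
theorem exists_posDef_sub_mul_mul_transpose {M : Matrix n n ℝ}
    (hM : Tendsto (fun k : ℕ => M ^ k) atTop (𝓝 0)) :
    ∃ S : Matrix n n ℝ, S.PosDef ∧ (S - M * S * Mᵀ).PosDef := by
  have hsq : Tendsto (fun k : ℕ => ‖M ^ k * (M ^ k)ᴴ‖) atTop (𝓝 0) := by
    have : Continuous fun X : Matrix n n ℝ => ‖X * Xᴴ‖ := by fun_prop
    simpa [Function.comp_def] using (this.tendsto 0).comp hM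
  obtain ⟨N, hN⟩ :=
    ((hsq.comp (tendsto_add_atTop_nat 1)).eventually_lt_const one_pos).exists
  refine ⟨∑ k ∈ Finset.range (N + 1), M ^ k * (M ^ k)ᴴ, ?_, ?_⟩
  · rw [Finset.sum_range_succ']
    refine PosDef.posSemidef_add (posSemidef_sum _ fun k _ => posSemidef_self_mul_conjTranspose _) ?_
    simpa using PosDef.one
  · have h := (isHermitian_mul_conjTranspose_self (M ^ (N + 1))).posDef_one_sub_of_norm_lt_one hN
    convert h using 1
    have hstep (k : ℕ) : M * (M ^ k * (M ^ k)ᴴ) * Mᵀ = M ^ (k + 1) * (M ^ (k + 1))ᴴ := by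
      simp only [pow_succ', conjTranspose_eq_transpose_of_trivial, transpose_mul, mul_assoc]
    rw [Finset.mul_sum, Finset.sum_mul, ← Finset.sum_sub_distrib]
    simp_rw [hstep]
    rw [Finset.sum_range_sub']
    simp

end Matrix

/-- The Cayley transform of a Hurwitz matrix has spectrum in the open unit disc. -/
theorem IsHurwitz.norm_lt_one_of_mem_spectrum_cayley {n : ℕ} {F : Matrix (Fin n) (Fin n) ℝ}
    (hF : IsHurwitz F) {M : Matrix (Fin n) (Fin n) ℝ} (hM : (1 - F) * M = 1 + F)
    (hU : IsUnit (1 - F)) {z : ℂ} (hz : z ∈ spectrum ℂ (M.map Complex.ofReal)) : ‖z‖ < 1 := by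
  set φ := (Complex.ofRealHom.mapMatrix : Matrix (Fin n) (Fin n) ℝ →+* _)
  change z ∈ spectrum ℂ (φ M) at hz
  have hF' : ∀ w ∈ spectrum ℂ (φ F), w.re < 0 := hF
  have hM' : (1 - φ F) * φ M = 1 + φ F := by simpa using congrArg φ hM
  have hU' : IsUnit (1 - φ F) := by simpa using hU.map φ
  have hnot : ¬ IsUnit (algebraMap ℂ _ (z - 1) - (z + 1) • φ F) := by
    intro h
    refine hz ?_
    rw [spectrum.mem_resolventSet_iff, ← hU'.mul_left_iff]
    convert h using 1
    rw [mul_sub, hM']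
    simp only [Algebra.algebraMap_eq_smul_one, sub_smul, add_smul, mul_smul_comm, mul_one, smul_sub,
      one_smul]
    abel
  have hz1 : z + 1 ≠ 0 := by
    intro h
    have hz' : z - 1 ≠ 0 := fun h' => by
      have : (2 : ℂ) = 0 := by linear_combination h - h'
      norm_num at this
    apply hnot
    rw [h, zero_smul, sub_zero]
    exact (isUnit_iff_ne_zero.mpr hz').map (algebraMap ℂ _)
  have hmem : (z - 1) / (z + 1) ∈ spectrum ℂ (φ F) := by
    intro h
    apply hnot
    have := h.smul (Units.mk0 _ hz1)
    convert this using 1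
    rw [Units.smul_mk0, smul_sub, Algebra.algebraMap_eq_smul_one, Algebra.algebraMap_eq_smul_one,
      smul_smul, mul_div_cancel₀ _ hz1]
  have hre := hF' _ hmem
  have hpos : 0 < Complex.normSq (z + 1) := Complex.normSq_pos.mpr hz1
  rw [Complex.div_re, ← add_div, div_lt_iff₀ hpos] at hre
  simp only [Complex.sub_re, Complex.add_re, Complex.one_re, Complex.sub_im, Complex.add_im,
    Complex.one_im] at hre
  rw [← sq_lt_one_iff₀ (norm_nonneg z), Complex.sq_norm, Complex.normSq_apply]
  nlinarith

/-- Lyapunov's theorem: a Hurwitz matrix admits a quadratic Lyapunov function. -/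
theorem IsHurwitz.exists_posDef_lyapunov {n : ℕ} {F : Matrix (Fin n) (Fin n) ℝ}
    (hF : IsHurwitz F) :
    ∃ S : Matrix (Fin n) (Fin n) ℝ, S.PosDef ∧ (-(S * Fᵀ + F * S)).PosDef := by
  have hU : IsUnit (1 - F) := by
    have h1 : IsUnit (algebraMap ℂ _ 1 - Complex.ofRealHom.mapMatrix F) := by
      by_contra h
      have := hF 1 h
      norm_num at this
    rw [map_one, ← map_one Complex.ofRealHom.mapMatrix, ← map_sub,
      isUnit_iff_isUnit_det, ← RingHom.map_det, isUnit_map_iff, ← isUnit_iff_isUnit_det] at h1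
    exact h1
  have hdet := (isUnit_iff_isUnit_det _).mp hU
  set M := (1 - F)⁻¹ * (1 + F)
  have hM : (1 - F) * M = 1 + F := mul_nonsing_inv_cancel_left _ _ hdet
  obtain ⟨S, hS, hD⟩ := exists_posDef_sub_mul_mul_transpose
    (tendsto_pow_zero_of_spectrum_map_ofReal
      fun _ hz => hF.norm_lt_one_of_mem_spectrum_cayley hM hU hz)
  refine ⟨S, hS, ?_⟩
  have h := (hD.mul_mul_conjTranspose_same (vecMul_injective_iff_isUnit.mpr hU)).smul
    (show (0 : ℝ) < 1 / 2 by norm_num)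
  convert h using 1
  have hMt : Mᵀ * (1 - F)ᵀ = 1 + Fᵀ := by
    rw [← transpose_mul, hM, transpose_add, transpose_one]
  have hcayley : (1 - F) * (M * S * Mᵀ) * (1 - F)ᵀ = (1 + F) * S * (1 + Fᵀ) := by
    rw [← hM, ← hMt]
    simp only [mul_assoc]
  rw [conjTranspose_eq_transpose_of_trivial, mul_sub, sub_mul, hcayley, transpose_sub,
    transpose_one]
  have h2 : (1 - F) * S * (1 - Fᵀ) - (1 + F) * S * (1 + Fᵀ) = (2 : ℝ) • -(S * Fᵀ + F * S) := by
    rw [two_smul]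
    noncomm_ring
  rw [h2, smul_smul]
  norm_num

theorem lmi_feasibility {n m : ℕ}
    (A : Matrix (Fin n) (Fin n) ℝ) (B : Matrix (Fin n) (Fin m) ℝ)
    (hStab : ∃ K : Matrix (Fin m) (Fin n) ℝ, IsHurwitz (A - B * K)) :
    ∃ (S : Matrix (Fin n) (Fin n) ℝ) (ϖ : ℝ), S.PosDef ∧ 0 < ϖ ∧
      (-(S * Aᵀ + A * S - ϖ • (B * Bᵀ))).PosDef := by
  obtain ⟨K, hK⟩ := hStab
  obtain ⟨S, hS, hQ⟩ := hK.exists_posDef_lyapunov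
  have hST : Sᵀ = S := by simpa using hS.isHermitian.eq
  set Y := K * S with hY
  obtain ⟨t, ht, ht0⟩ := (((hQ.eventually_sub_smul
    (isHermitian_conjTranspose_mul_self Y)).filter_mono nhdsWithin_le_nhds).and
      (self_mem_nhdsWithin (s := Set.Ioi (0 : ℝ)))).exists
  have ht0 : 0 < t := ht0
  refine ⟨S, t⁻¹, hS, inv_pos.mpr ht0, ?_⟩
  have hsq := (posSemidef_self_mul_conjTranspose (B - t • Yᵀ)).smul (inv_pos.mpr ht0).le
  convert ht.add_posSemidef hsq using 1
  have hYT : Yᵀ = S * Kᵀ := by rw [hY, transpose_mul, hST]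
  have hexp : t⁻¹ • ((B - t • Yᵀ) * (B - t • Yᵀ)ᴴ) =
      t⁻¹ • (B * Bᵀ) - B * Y - Yᵀ * Bᵀ + t • (Yᵀ * Y) := by
    simp only [conjTranspose_eq_transpose_of_trivial, transpose_sub, transpose_smul,
      transpose_transpose, Matrix.sub_mul, Matrix.mul_sub, Matrix.smul_mul, Matrix.mul_smul,
      smul_sub, smul_smul, inv_mul_cancel₀ ht0.ne', inv_mul_cancel_left₀ ht0.ne', one_smul]
    abel
  have hF : S * (A - B * K)ᵀ + (A - B * K) * S = S * Aᵀ + A * S - Yᵀ * Bᵀ - B * Y := by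
    rw [hYT, hY, transpose_sub, transpose_mul, Matrix.mul_sub, Matrix.sub_mul, Matrix.mul_assoc,
      Matrix.mul_assoc]
    abel
  rw [hexp, hF, conjTranspose_eq_transpose_of_trivial]
  abel
end

section
/- Let A be a real n×n matrix, B a real n×m matrix, S a symmetric positive definite n×n matrix, and ϖ > 0 a real number such that S Aᵀ + A S − ϖ B Bᵀ is negative definite. Then the feedback gain K = (ϖ/2) Bᵀ S⁻¹ stabilizes the system: A − B·K is Hurwitz. -/
open Matrix

/-- Lyapunov's criterion: if `S` is positive definite and `S * Fᵀ + F * S` is negative definite,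
then `F` is Hurwitz. -/
theorem IsHurwitz.of_lyapunov {n : ℕ} {F S : Matrix (Fin n) (Fin n) ℝ} (hS : S.PosDef)
    (h : (-(S * Fᵀ + F * S)).PosDef) : IsHurwitz F := by
  intro μ hμ
  rw [spectrum.mem_iff, Matrix.isUnit_iff_isUnit_det, isUnit_iff_ne_zero, not_not,
    ← Matrix.exists_vecMul_eq_zero_iff] at hμ
  obtain ⟨v, hv, hvF⟩ := hμ
  rw [Matrix.vecMul_sub, sub_eq_zero, Algebra.algebraMap_eq_smul_one, Matrix.vecMul_smul,
    Matrix.vecMul_one] at hvF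
  set x : Fin n → ℝ := fun i => (v i).re with hx
  set y : Fin n → ℝ := fun i => (v i).im with hy
  have hxF : x ᵥ* F = μ.re • x - μ.im • y := by
    ext i
    have := congrArg Complex.re (congrFun hvF i)
    simpa [Matrix.vecMul, dotProduct, hx, hy] using this.symm
  have hyF : y ᵥ* F = μ.re • y + μ.im • x := by
    ext i
    have := congrArg Complex.im (congrFun hvF i)
    simpa [Matrix.vecMul, dotProduct, hx, hy] using this.symm
  have hsymm : Sᵀ = S := by simpa using hS.isHermitian.eq
  have hswap (u w : Fin n → ℝ) : u ⬝ᵥ S *ᵥ w = w ⬝ᵥ S *ᵥ u := by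
    rw [Matrix.dotProduct_mulVec, ← Matrix.mulVec_transpose, hsymm, dotProduct_comm]
  have hquad (u : Fin n → ℝ) :
      u ⬝ᵥ (-(S * Fᵀ + F * S)) *ᵥ u = -(2 * ((u ᵥ* F) ⬝ᵥ S *ᵥ u)) := by
    rw [Matrix.neg_mulVec, dotProduct_neg, Matrix.add_mulVec, dotProduct_add,
      ← Matrix.mulVec_mulVec, ← Matrix.mulVec_mulVec, Matrix.mulVec_transpose, hswap u,
      Matrix.dotProduct_mulVec u F, two_mul]
  have hsum : x ⬝ᵥ (-(S * Fᵀ + F * S)) *ᵥ x + y ⬝ᵥ (-(S * Fᵀ + F * S)) *ᵥ y =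
      -(2 * μ.re * (x ⬝ᵥ S *ᵥ x + y ⬝ᵥ S *ᵥ y)) := by
    rw [hquad, hquad, hxF, hyF]
    simp only [sub_dotProduct, add_dotProduct, smul_dotProduct, smul_eq_mul]
    rw [hswap y x]
    ring
  have hxy : x ≠ 0 ∨ y ≠ 0 := by
    by_contra! hzero
    exact hv (funext fun i => Complex.ext (congrFun hzero.1 i) (congrFun hzero.2 i))
  have hpos {M : Matrix (Fin n) (Fin n) ℝ} (hM : M.PosDef) :
      0 < x ⬝ᵥ M *ᵥ x + y ⬝ᵥ M *ᵥ y := by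
    have hx0 : 0 ≤ x ⬝ᵥ M *ᵥ x := by simpa using hM.posSemidef.dotProduct_mulVec_nonneg x
    have hy0 : 0 ≤ y ⬝ᵥ M *ᵥ y := by simpa using hM.posSemidef.dotProduct_mulVec_nonneg y
    rcases hxy with hne | hne
    · have : 0 < x ⬝ᵥ M *ᵥ x := by simpa using hM.dotProduct_mulVec_pos hne
      linarith
    · have : 0 < y ⬝ᵥ M *ᵥ y := by simpa using hM.dotProduct_mulVec_pos hne
      linarith
  have hQ := hpos h
  rw [hsum] at hQ
  nlinarith [hpos hS]

theorem lmi_stabilizing_gain {n m : ℕ}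
    (A : Matrix (Fin n) (Fin n) ℝ) (B : Matrix (Fin n) (Fin m) ℝ)
    (S : Matrix (Fin n) (Fin n) ℝ) (hS : S.PosDef)
    (ϖ : ℝ) (hϖ : 0 < ϖ)
    (hLMI : (-(S * Aᵀ + A * S - ϖ • (B * Bᵀ))).PosDef) :
    IsHurwitz (A - B * ((ϖ / 2) • (Bᵀ * S⁻¹))) := by
  have hsymm : Sᵀ = S := by simpa using hS.isHermitian.eq
  have hdet : IsUnit S.det := (Matrix.isUnit_iff_isUnit_det S).1 hS.isUnit
  have hright : B * ((ϖ / 2) • (Bᵀ * S⁻¹)) * S = (ϖ / 2) • (B * Bᵀ) := by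
    rw [Matrix.mul_smul, Matrix.smul_mul, Matrix.mul_assoc, Matrix.mul_assoc,
      Matrix.nonsing_inv_mul S hdet, Matrix.mul_one]
  have hleft : S * (B * ((ϖ / 2) • (Bᵀ * S⁻¹)))ᵀ = (ϖ / 2) • (B * Bᵀ) := by
    simpa [Matrix.transpose_mul, hsymm] using congrArg Matrix.transpose hright
  refine IsHurwitz.of_lyapunov hS ?_
  convert hLMI using 2
  rw [Matrix.transpose_sub, Matrix.mul_sub, Matrix.sub_mul, hleft, hright]
  module
end

section
/- Let A be a real n×n matrix, B a real n×m matrix, M a symmetric positive semidefinite n×n matrix with (A, M) observable, and R a symmetric positive definite m×m matrix. If P is a symmetric positive semidefinite n×n matrix satisfying the algebraic Riccati equation Aᵀ P + P A + M − P B R⁻¹ Bᵀ P = 0, then the closed-loop matrix A − B R⁻¹ Bᵀ P is Hurwitz. -/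
open Matrix

/-- A complex eigenvalue of a real matrix yields real vectors `x`, `y`, not both zero, spanning an
invariant subspace: the real and imaginary parts of an eigenvector. -/
theorem exists_real_eigenpair {n : ℕ} {F : Matrix (Fin n) (Fin n) ℝ} {μ : ℂ}
    (hμ : μ ∈ spectrum ℂ (F.map Complex.ofReal)) :
    ∃ x y : Fin n → ℝ, (x ≠ 0 ∨ y ≠ 0) ∧
      F *ᵥ x = μ.re • x - μ.im • y ∧ F *ᵥ y = μ.im • x + μ.re • y := by
  rw [← Matrix.spectrum_toLin', ← Module.End.hasEigenvalue_iff_mem_spectrum] at hμ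
  obtain ⟨z, hz⟩ := hμ.exists_hasEigenvector
  have hzμ : F.map Complex.ofReal *ᵥ z = μ • z := by simpa using hz.apply_eq_smul
  refine ⟨fun i => (z i).re, fun i => (z i).im, ?_, ?_, ?_⟩
  · by_contra! h
    refine hz.2 (funext fun i => Complex.ext ?_ ?_)
    · exact congrFun h.1 i
    · exact congrFun h.2 i
  · funext i
    simpa [mulVec, dotProduct] using congrArg Complex.re (congrFun hzμ i)
  · funext i
    simpa [mulVec, dotProduct, add_comm] using congrArg Complex.im (congrFun hzμ i)

/-- Observability forbids a nonzero `A`-invariant span of two vectors inside the kernel of `C`. -/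
theorem IsObservable.eq_zero_of_invariant {n p : ℕ} {A : Matrix (Fin n) (Fin n) ℝ}
    {C : Matrix (Fin p) (Fin n) ℝ} (h : IsObservable A C) {x y : Fin n → ℝ} {a b c d : ℝ}
    (hx : A *ᵥ x = a • x + b • y) (hy : A *ᵥ y = c • x + d • y)
    (hCx : C *ᵥ x = 0) (hCy : C *ᵥ y = 0) : x = 0 ∧ y = 0 := by
  have key : ∀ k, C *ᵥ (A ^ k *ᵥ x) = 0 ∧ C *ᵥ (A ^ k *ᵥ y) = 0 := by
    intro k
    induction k with
    | zero => simp [hCx, hCy]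
    | succ k ih =>
      rw [pow_succ, ← mulVec_mulVec, ← mulVec_mulVec, hx, hy]
      simp [mulVec_add, mulVec_smul, ih]
  exact ⟨h x fun k _ => (key k).1, h y fun k _ => (key k).2⟩

theorem riccati_closedLoop_lyapunov {n : ℕ} {A M P S : Matrix (Fin n) (Fin n) ℝ}
    (hP : Pᵀ = P) (hS : Sᵀ = S) (h : Aᵀ * P + P * A + M - P * S * P = 0) :
    (A - S * P)ᵀ * P + P * (A - S * P) + M + P * S * P = 0 := by
  rw [← h]
  simp only [transpose_sub, transpose_mul, hP, hS]
  noncomm_ring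

/-- If `a`, `b` are the real and imaginary parts of an eigenvalue of `F` with eigenvector
`x + i y`, this is the Lyapunov form of `F` evaluated at that eigenvector. -/
theorem lyapunov_form_eigenpair {n : ℕ} {F P : Matrix (Fin n) (Fin n) ℝ} (hP : Pᵀ = P)
    {x y : Fin n → ℝ} {a b : ℝ} (hx : F *ᵥ x = a • x - b • y) (hy : F *ᵥ y = b • x + a • y) :
    x ⬝ᵥ (Fᵀ * P + P * F) *ᵥ x + y ⬝ᵥ (Fᵀ * P + P * F) *ᵥ y =
      2 * a * (x ⬝ᵥ P *ᵥ x + y ⬝ᵥ P *ᵥ y) := by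
  have hsymm : ∀ u v : Fin n → ℝ, u ⬝ᵥ P *ᵥ v = v ⬝ᵥ P *ᵥ u := fun u v => by
    rw [dotProduct_mulVec, ← mulVec_transpose, hP, dotProduct_comm]
  have hform : ∀ u : Fin n → ℝ,
      u ⬝ᵥ (Fᵀ * P + P * F) *ᵥ u = 2 * (u ⬝ᵥ P *ᵥ (F *ᵥ u)) := fun u => by
    rw [add_mulVec, dotProduct_add, ← mulVec_mulVec, ← mulVec_mulVec, dotProduct_mulVec u Fᵀ,
      vecMul_transpose, hsymm (F *ᵥ u)]
    ring
  rw [hform, hform, hx, hy]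
  simp only [mulVec_add, mulVec_sub, mulVec_smul, dotProduct_add, dotProduct_sub, dotProduct_smul,
    smul_eq_mul]
  rw [hsymm y x]
  ring

theorem riccati_solution_stabilizing {n m : ℕ}
    (A : Matrix (Fin n) (Fin n) ℝ) (B : Matrix (Fin n) (Fin m) ℝ)
    (M : Matrix (Fin n) (Fin n) ℝ) (R : Matrix (Fin m) (Fin m) ℝ)
    (hM : M.PosSemidef) (hR : R.PosDef) (hObs : IsObservable A M)
    (P : Matrix (Fin n) (Fin n) ℝ) (hP : P.PosSemidef)
    (hRiccati : Aᵀ * P + P * A + M - P * B * R⁻¹ * Bᵀ * P = 0) :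
    IsHurwitz (A - B * (R⁻¹ * Bᵀ * P)) := by
  intro μ hμ
  obtain ⟨S, hSdef⟩ : ∃ S, S = B * R⁻¹ * Bᵀ := ⟨_, rfl⟩
  have hS : S.PosSemidef := by
    simpa [hSdef] using hR.inv.posSemidef.mul_mul_conjTranspose_same B
  have hPt : Pᵀ = P := by simpa using hP.isHermitian.eq
  have hSt : Sᵀ = S := by simpa using hS.isHermitian.eq
  rw [show A - B * (R⁻¹ * Bᵀ * P) = A - S * P by simp only [hSdef, Matrix.mul_assoc]] at hμ
  have hL := riccati_closedLoop_lyapunov (A := A) (M := M) hPt hSt (by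
    simpa only [hSdef, Matrix.mul_assoc] using hRiccati)
  obtain ⟨x, y, hne, hx, hy⟩ := exists_real_eigenpair hμ
  by_contra! hre
  have hnonneg {N : Matrix (Fin n) (Fin n) ℝ} (hN : N.PosSemidef) (u : Fin n → ℝ) :
      0 ≤ u ⬝ᵥ N *ᵥ u := by simpa using hN.dotProduct_mulVec_nonneg u
  have hker {N : Matrix (Fin n) (Fin n) ℝ} (hN : N.PosSemidef) {u : Fin n → ℝ}
      (h : u ⬝ᵥ N *ᵥ u = 0) : N *ᵥ u = 0 :=
    (hN.dotProduct_mulVec_zero_iff u).1 (by simpa using h)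
  have hPSP (u : Fin n → ℝ) : u ⬝ᵥ (P * S * P) *ᵥ u = (P *ᵥ u) ⬝ᵥ S *ᵥ (P *ᵥ u) := by
    rw [Matrix.mul_assoc, ← mulVec_mulVec, ← mulVec_mulVec, dotProduct_mulVec,
      ← mulVec_transpose, hPt]
  have hLu (u : Fin n → ℝ) :
      u ⬝ᵥ ((A - S * P)ᵀ * P + P * (A - S * P)) *ᵥ u + u ⬝ᵥ M *ᵥ u
        + (P *ᵥ u) ⬝ᵥ S *ᵥ (P *ᵥ u) = 0 := by
    rw [← hPSP, ← dotProduct_add, ← add_mulVec, ← dotProduct_add, ← add_mulVec, hL]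
    simp
  have hform := lyapunov_form_eigenpair hPt hx hy
  have hPos := mul_nonneg (mul_nonneg zero_le_two hre) (add_nonneg (hnonneg hP x) (hnonneg hP y))
  have hLx := hLu x
  have hLy := hLu y
  have hMx := hnonneg hM x
  have hMy := hnonneg hM y
  have hSx := hnonneg hS (P *ᵥ x)
  have hSy := hnonneg hS (P *ᵥ y)
  have hSPx : S *ᵥ (P *ᵥ x) = 0 := hker hS (by linarith)
  have hSPy : S *ᵥ (P *ᵥ y) = 0 := hker hS (by linarith)
  rw [sub_mulVec, ← mulVec_mulVec, hSPx, sub_zero, sub_eq_add_neg, ← neg_smul] at hx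
  rw [sub_mulVec, ← mulVec_mulVec, hSPy, sub_zero] at hy
  have hzero := hObs.eq_zero_of_invariant hx hy (hker hM (by linarith)) (hker hM (by linarith))
  exact hne.elim (· hzero.1) (· hzero.2)
end

section
/- Let A ∈ ℝ^{n×n}, B ∈ ℝ^{n×m}, let M ∈ ℝ^{n×n} and R ∈ ℝ^{m×m} be symmetric, and let P̂ ∈ ℝ^{n×n} be symmetric. Define Λ_xx = M + P̂ A + Aᵀ P̂ and Λ_xu = P̂ B. Let x : ℝ → ℝⁿ be differentiable and u : ℝ → ℝᵐ continuous with x'(t) = A x(t) + B u(t) for all t ∈ [t₀, t₁]. Then ∫_{t₀}^{t₁} ( x(τ)ᵀ M x(τ) + u(τ)ᵀ R u(τ) ) dτ + x(t₁)ᵀ P̂ x(t₁) − x(t₀)ᵀ P̂ x(t₀) = ∫_{t₀}^{t₁} ( x(τ)ᵀ Λ_xx x(τ) + 2 x(τ)ᵀ Λ_xu u(τ) + u(τ)ᵀ R u(τ) ) dτ. -/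
open Matrix intervalIntegral

/-- The product rule for the quadratic form of a symmetric matrix along a curve. -/
theorem Matrix.IsSymm.hasDerivAt_dotProduct_mulVec {ι : Type*} [Fintype ι]
    {P : Matrix ι ι ℝ} (hP : P.IsSymm) {x : ℝ → ι → ℝ} {x' : ι → ℝ} {t : ℝ}
    (hx : HasDerivAt x x' t) :
    HasDerivAt (fun s => x s ⬝ᵥ P *ᵥ x s) (2 * (x t ⬝ᵥ P *ᵥ x')) t := by
  have hcoord := hasDerivAt_pi.mp hx
  have hmulVec (i : ι) : HasDerivAt (fun s => (P *ᵥ x s) i) ((P *ᵥ x') i) t :=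
    HasDerivAt.fun_sum fun j _ => (hcoord j).const_mul (P i j)
  have hsum : HasDerivAt (fun s => x s ⬝ᵥ P *ᵥ x s) (x' ⬝ᵥ P *ᵥ x t + x t ⬝ᵥ P *ᵥ x') t := by
    simp only [dotProduct, ← Finset.sum_add_distrib]
    exact HasDerivAt.fun_sum fun i _ => (hcoord i).mul (hmulVec i)
  have hcomm : x' ⬝ᵥ P *ᵥ x t = x t ⬝ᵥ P *ᵥ x' := by
    rw [dotProduct_comm, ← vecMul_transpose, hP.eq, ← dotProduct_mulVec]
  rwa [hcomm, ← two_mul] at hsum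

/-- The advantage function is the running cost plus the rate of change of `x ⬝ᵥ P *ᵥ x` along
the vector field `A *ᵥ x + B *ᵥ u`. -/
theorem Matrix.IsSymm.advantage_eq {ι κ : Type*} [Fintype ι] [Fintype κ]
    {P : Matrix ι ι ℝ} (hP : P.IsSymm) (A M : Matrix ι ι ℝ) (B : Matrix ι κ ℝ)
    (R : Matrix κ κ ℝ) (x : ι → ℝ) (u : κ → ℝ) :
    x ⬝ᵥ (M + P * A + Aᵀ * P) *ᵥ x + 2 * (x ⬝ᵥ (P * B) *ᵥ u) + u ⬝ᵥ R *ᵥ u =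
      (x ⬝ᵥ M *ᵥ x + u ⬝ᵥ R *ᵥ u) + 2 * (x ⬝ᵥ P *ᵥ (A *ᵥ x + B *ᵥ u)) := by
  have htranspose : x ⬝ᵥ (Aᵀ * P) *ᵥ x = x ⬝ᵥ (P * A) *ᵥ x := by
    rw [dotProduct_mulVec, ← mulVec_transpose, transpose_mul, transpose_transpose, hP.eq,
      dotProduct_comm]
  simp only [add_mulVec, dotProduct_add, mulVec_add, mulVec_mulVec, htranspose]
  ring

theorem advantage_function_integral_identity {n m : ℕ}
    (A : Matrix (Fin n) (Fin n) ℝ) (B : Matrix (Fin n) (Fin m) ℝ)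
    (M : Matrix (Fin n) (Fin n) ℝ) (R : Matrix (Fin m) (Fin m) ℝ)
    (hM : M.IsSymm) (hR : R.IsSymm)
    (Phat : Matrix (Fin n) (Fin n) ℝ) (hPhat : Phat.IsSymm)
    (x : ℝ → Fin n → ℝ) (u : ℝ → Fin m → ℝ)
    (hx : Differentiable ℝ x) (hu : Continuous u)
    (t₀ t₁ : ℝ) (ht : t₀ ≤ t₁)
    (hode : ∀ t ∈ Set.Icc t₀ t₁, deriv x t = A.mulVec (x t) + B.mulVec (u t)) :
    (∫ τ in t₀..t₁, (x τ ⬝ᵥ M.mulVec (x τ) + u τ ⬝ᵥ R.mulVec (u τ))) +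
        x t₁ ⬝ᵥ Phat.mulVec (x t₁) - x t₀ ⬝ᵥ Phat.mulVec (x t₀) =
      ∫ τ in t₀..t₁,
        (x τ ⬝ᵥ (M + Phat * A + Aᵀ * Phat).mulVec (x τ) +
          2 * (x τ ⬝ᵥ (Phat * B).mulVec (u τ)) + u τ ⬝ᵥ R.mulVec (u τ)) := by
  have hxc := hx.continuous
  have hderiv : ∀ t ∈ Set.uIcc t₀ t₁, HasDerivAt (fun s => x s ⬝ᵥ Phat *ᵥ x s)
      (2 * (x t ⬝ᵥ Phat *ᵥ (A *ᵥ x t + B *ᵥ u t))) t := fun t htt => by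
    rw [← hode t (Set.uIcc_of_le ht ▸ htt)]
    exact hPhat.hasDerivAt_dotProduct_mulVec (hx t).hasDerivAt
  have hcost : Continuous fun t => x t ⬝ᵥ M *ᵥ x t + u t ⬝ᵥ R *ᵥ u t := by fun_prop
  have hrate : Continuous fun t => 2 * (x t ⬝ᵥ Phat *ᵥ (A *ᵥ x t + B *ᵥ u t)) := by fun_prop
  simp only [hPhat.advantage_eq]
  rw [integral_add (hcost.intervalIntegrable _ _) (hrate.intervalIntegrable _ _),
    integral_eq_sub_of_hasDerivAt hderiv (hrate.intervalIntegrable _ _), add_sub_assoc]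
end

section
/- Let A ∈ ℝ^{n×n}, B ∈ ℝ^{n×m}, M ∈ ℝ^{n×n} and R ∈ ℝ^{m×m} symmetric, K ∈ ℝ^{m×n}, and let P ∈ ℝ^{n×n} be a symmetric matrix satisfying (A − B K)ᵀ P + P (A − B K) = −(M + Kᵀ R K). Let x : ℝ → ℝⁿ be differentiable and u : ℝ → ℝᵐ continuous with x'(t) = A x(t) + B u(t) for all t ∈ [t₀, t₁]. Then x(t₁)ᵀ P x(t₁) − x(t₀)ᵀ P x(t₀) = ∫_{t₀}^{t₁} ( −x(τ)ᵀ M x(τ) − x(τ)ᵀ Kᵀ R K x(τ) ) dτ + 2 ∫_{t₀}^{t₁} ( u(τ) + K x(τ) )ᵀ Bᵀ P x(τ) dτ. -/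
open Matrix intervalIntegral

theorem HasDerivAt.matrix_dotProduct {ι : Type*} [Fintype ι] {f g : ℝ → ι → ℝ} {f' g' : ι → ℝ}
    {t : ℝ} (hf : HasDerivAt f f' t) (hg : HasDerivAt g g' t) :
    HasDerivAt (fun s => f s ⬝ᵥ g s) (f' ⬝ᵥ g t + f t ⬝ᵥ g') t := by
  simp only [dotProduct, ← Finset.sum_add_distrib]
  exact HasDerivAt.fun_sum fun i _ => (hasDerivAt_pi.1 hf i).mul (hasDerivAt_pi.1 hg i)

theorem HasDerivAt.matrix_mulVec {ι κ : Type*} [Fintype ι] [Fintype κ] (P : Matrix κ ι ℝ)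
    {f : ℝ → ι → ℝ} {f' : ι → ℝ} {t : ℝ} (hf : HasDerivAt f f' t) :
    HasDerivAt (fun s => P *ᵥ f s) (P *ᵥ f') t :=
  P.mulVecLin.toContinuousLinearMap.hasFDerivAt.comp_hasDerivAt t hf

theorem Matrix.IsSymm.dotProduct_mulVec_comm_s12 {ι : Type*} [Fintype ι] {P : Matrix ι ι ℝ}
    (hP : P.IsSymm) (v w : ι → ℝ) : v ⬝ᵥ P *ᵥ w = w ⬝ᵥ P *ᵥ v := by
  rw [dotProduct_mulVec, ← mulVec_transpose, hP.eq, dotProduct_comm]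

theorem Matrix.dotProduct_transpose_mul_mulVec {ι κ l : Type*} [Fintype ι] [Fintype κ] [Fintype l]
    (C : Matrix κ ι ℝ) (P : Matrix κ l ℝ) (v : ι → ℝ) (w : l → ℝ) :
    v ⬝ᵥ (Cᵀ * P) *ᵥ w = (C *ᵥ v) ⬝ᵥ P *ᵥ w := by
  rw [← mulVec_mulVec, dotProduct_mulVec, vecMul_transpose]

/-- The derivative of the quadratic form of `P` along `v' = A v + B w`, expressed through the
Lyapunov equation of the closed loop `A - B K`. -/
theorem lyapunov_quadratic_form_deriv {ι κ : Type*} [Fintype ι] [Fintype κ]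
    {A P M : Matrix ι ι ℝ} {B : Matrix ι κ ℝ} {R : Matrix κ κ ℝ} {K : Matrix κ ι ℝ}
    (hP : P.IsSymm) (hLyap : (A - B * K)ᵀ * P + P * (A - B * K) = -(M + Kᵀ * R * K))
    (v : ι → ℝ) (w : κ → ℝ) :
    (A *ᵥ v + B *ᵥ w) ⬝ᵥ P *ᵥ v + v ⬝ᵥ P *ᵥ (A *ᵥ v + B *ᵥ w) =
      (-(v ⬝ᵥ M *ᵥ v) - v ⬝ᵥ (Kᵀ * R * K) *ᵥ v) + 2 * ((w + K *ᵥ v) ⬝ᵥ (Bᵀ * P) *ᵥ v) := by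
  have h := congrArg (fun N : Matrix ι ι ℝ => v ⬝ᵥ N *ᵥ v) hLyap
  simp only [add_mulVec, neg_mulVec, dotProduct_add, dotProduct_neg,
    dotProduct_transpose_mul_mulVec (A - B * K)] at h
  rw [← mulVec_mulVec, hP.dotProduct_mulVec_comm_s12 v, sub_mulVec, sub_dotProduct,
    ← mulVec_mulVec] at h
  rw [hP.dotProduct_mulVec_comm_s12 v, dotProduct_transpose_mul_mulVec B, mulVec_add,
    add_dotProduct, add_dotProduct]
  linarith

theorem off_policy_value_evaluation_identity {n m : ℕ}
    (A : Matrix (Fin n) (Fin n) ℝ) (B : Matrix (Fin n) (Fin m) ℝ)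
    (M : Matrix (Fin n) (Fin n) ℝ) (R : Matrix (Fin m) (Fin m) ℝ)
    (hM : M.IsSymm) (hR : R.IsSymm)
    (K : Matrix (Fin m) (Fin n) ℝ)
    (P : Matrix (Fin n) (Fin n) ℝ) (hPsymm : P.IsSymm)
    (hLyap : (A - B * K)ᵀ * P + P * (A - B * K) = -(M + Kᵀ * R * K))
    (x : ℝ → Fin n → ℝ) (u : ℝ → Fin m → ℝ)
    (hx : Differentiable ℝ x) (hu : Continuous u)
    (t₀ t₁ : ℝ) (ht : t₀ ≤ t₁)
    (hode : ∀ t ∈ Set.Icc t₀ t₁, deriv x t = A.mulVec (x t) + B.mulVec (u t)) :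
    x t₁ ⬝ᵥ P.mulVec (x t₁) - x t₀ ⬝ᵥ P.mulVec (x t₀) =
      (∫ τ in t₀..t₁,
        (-(x τ ⬝ᵥ M.mulVec (x τ)) - x τ ⬝ᵥ (Kᵀ * R * K).mulVec (x τ))) +
      2 * ∫ τ in t₀..t₁, (u τ + K.mulVec (x τ)) ⬝ᵥ (Bᵀ * P).mulVec (x τ) := by
  have hxc : Continuous x := hx.continuous
  have h₁ : Continuous fun τ =>
      -(x τ ⬝ᵥ M.mulVec (x τ)) - x τ ⬝ᵥ (Kᵀ * R * K).mulVec (x τ) := by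
    fun_prop
  have h₂ : Continuous fun τ => (u τ + K.mulVec (x τ)) ⬝ᵥ (Bᵀ * P).mulVec (x τ) := by
    fun_prop
  rw [← integral_const_mul, ← integral_add (h₁.intervalIntegrable _ _)
    ((h₂.const_mul 2).intervalIntegrable _ _)]
  refine (integral_eq_sub_of_hasDerivAt (f := fun τ => x τ ⬝ᵥ P.mulVec (x τ)) (fun t hmem => ?_)
    ((h₁.add (h₂.const_mul 2)).intervalIntegrable _ _)).symm
  rw [Set.uIcc_of_le ht] at hmem
  have hd := (hx t).hasDerivAt
  rw [hode t hmem] at hd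
  have hq := hd.matrix_dotProduct (hd.matrix_mulVec P)
  rwa [lyapunov_quadratic_form_deriv hPsymm hLyap] at hq
end

section
/- Let γ ∈ ℝ, let V : ℝⁿ → ℝ be differentiable, let X : ℝ → ℝⁿ be differentiable, and let q : ℝ → ℝ be continuous. Suppose that for every t ∈ ℝ and every T > 0, e^{−γT} V(X(t+T)) − V(X(t)) = −∫_t^{t+T} e^{−γ(τ−t)} q(τ) dτ. Then for every t ∈ ℝ, q(t) − γ V(X(t)) + DV(X(t))[X'(t)] = 0. -/
theorem irl_equation_implies_hjb {n : ℕ}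
    (γ : ℝ) (V : (Fin n → ℝ) → ℝ) (hV : Differentiable ℝ V)
    (X : ℝ → Fin n → ℝ) (hX : Differentiable ℝ X)
    (q : ℝ → ℝ) (hq : Continuous q)
    (hIRL : ∀ t : ℝ, ∀ T : ℝ, 0 < T →
      Real.exp (-γ * T) * V (X (t + T)) - V (X t) =
        -∫ τ in t..(t + T), Real.exp (-γ * (τ - t)) * q τ) :
    ∀ t : ℝ, q t - γ * V (X t) + fderiv ℝ V (X t) (deriv X t) = 0 := by
  intro t
  have hVX : HasDerivAt (fun s => V (X s)) (fderiv ℝ V (X t) (deriv X t)) t :=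
    (hV (X t)).hasFDerivAt.comp_hasDerivAt t (hX t).hasDerivAt
  have hexp : HasDerivAt (fun s : ℝ => Real.exp (-γ * (s - t)))
      (Real.exp (-γ * (t - t)) * (-γ * 1)) t :=
    (((hasDerivAt_id t).sub_const t).const_mul (-γ)).exp
  have hcont : Continuous fun τ : ℝ => Real.exp (-γ * (τ - t)) * q τ := by fun_prop
  have hint : HasDerivAt (fun s => V (X t) - ∫ τ in t..s, Real.exp (-γ * (τ - t)) * q τ)
      (-(Real.exp (-γ * (t - t)) * q t)) t :=
    (hcont.integral_hasStrictDerivAt t t).hasDerivAt.const_sub (V (X t))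
  have heq : ∀ s ∈ Set.Ici t, Real.exp (-γ * (s - t)) * V (X s) =
      V (X t) - ∫ τ in t..s, Real.exp (-γ * (τ - t)) * q τ := by
    intro s hs
    rcases (Set.mem_Ici.mp hs).eq_or_lt with rfl | hlt
    · simp
    · have h := hIRL t (s - t) (sub_pos.mpr hlt)
      rw [add_sub_cancel] at h
      linarith
  have hderiv := (uniqueDiffOn_Ici t t Set.self_mem_Ici).eq_deriv _
    (hexp.mul hVX).hasDerivWithinAt
    (hint.hasDerivWithinAt.congr heq (heq t Set.self_mem_Ici))
  simp only [sub_self, mul_zero, Real.exp_zero, one_mul, mul_one] at hderiv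
  linarith
end

section
/- Let λ > 0, r > 0, and p ∈ ℝ. Define g : (−λ, λ) → ℝ by g(u) = 2 λ r u · artanh(u/λ) + λ² r · ln( 1 − u²/λ² ) + p·u. Then g attains a strict global minimum on (−λ, λ) at the unique point u* = −λ · tanh( p / (2 r λ) ). -/
/-- The inverse hyperbolic tangent. -/
noncomputable def artanh (x : ℝ) : ℝ := Real.log ((1 + x) / (1 - x)) / 2

theorem mul_log_sub_log_lt {a b : ℝ} (ha : 0 < a) (hb : 0 < b) (hab : a ≠ b) :
    a * (Real.log b - Real.log a) < b - a := by
  have h := Real.log_lt_sub_one_of_pos (div_pos hb ha)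
    (fun h => hab ((div_eq_one_iff_eq ha.ne').1 h).symm)
  rw [Real.log_div hb.ne' ha.ne'] at h
  calc a * (Real.log b - Real.log a) < a * (b / a - 1) := mul_lt_mul_of_pos_left h ha
    _ = b - a := by field_simp

theorem two_mul_artanh {x : ℝ} (hx : x ∈ Set.Ioo (-1) 1) :
    2 * artanh x = Real.log (1 + x) - Real.log (1 - x) := by
  rw [artanh, Real.log_div (by linarith [hx.1]) (by linarith [hx.2])]
  ring

theorem log_one_sub_sq {x : ℝ} (hx : x ∈ Set.Ioo (-1) 1) :
    Real.log (1 - x ^ 2) = Real.log (1 + x) + Real.log (1 - x) := by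
  rw [← Real.log_mul (by linarith [hx.1]) (by linarith [hx.2])]
  ring_nf

theorem artanh_neg_tanh (x : ℝ) : artanh (-Real.tanh x) = -x := by
  rw [← Real.tanh_neg]
  have h := Real.artanh_eq_half_log (x := Real.tanh (-x))
    ⟨(Real.neg_one_lt_tanh _).le, (Real.tanh_lt_one _).le⟩
  rw [Real.artanh_tanh] at h
  rw [artanh]
  linarith

/-- The normalized penalty `x ↦ 2 x artanh x + log (1 - x ^ 2)` lies strictly above its tangent
lines, whose slope at `y` is `2 artanh y`. -/
theorem normalized_penalty_tangent_lt {x y : ℝ} (hx : x ∈ Set.Ioo (-1) 1)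
    (hy : y ∈ Set.Ioo (-1) 1) (hxy : x ≠ y) :
    2 * x * artanh y + Real.log (1 - y ^ 2) < 2 * x * artanh x + Real.log (1 - x ^ 2) := by
  have h₁ := mul_log_sub_log_lt (a := 1 + x) (b := 1 + y) (by linarith [hx.1])
    (by linarith [hy.1]) (fun h => hxy (by linarith))
  have h₂ := mul_log_sub_log_lt (a := 1 - x) (b := 1 - y) (by linarith [hx.2])
    (by linarith [hy.2]) (fun h => hxy (by linarith))
  rw [log_one_sub_sq hx, log_one_sub_sq hy]
  linear_combination h₁ + h₂ + x * two_mul_artanh hy - x * two_mul_artanh hx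

theorem constrained_penalty_strict_min (lam r p : ℝ) (hlam : 0 < lam) (hr : 0 < r) :
    -lam * Real.tanh (p / (2 * r * lam)) ∈ Set.Ioo (-lam) lam ∧
    ∀ u ∈ Set.Ioo (-lam) lam, u ≠ -lam * Real.tanh (p / (2 * r * lam)) →
      (2 * lam * r * (-lam * Real.tanh (p / (2 * r * lam))) *
          artanh ((-lam * Real.tanh (p / (2 * r * lam))) / lam) +
        lam ^ 2 * r *
          Real.log (1 - (-lam * Real.tanh (p / (2 * r * lam))) ^ 2 / lam ^ 2) +
        p * (-lam * Real.tanh (p / (2 * r * lam)))) <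
      (2 * lam * r * u * artanh (u / lam) +
        lam ^ 2 * r * Real.log (1 - u ^ 2 / lam ^ 2) + p * u) := by
  set q := p / (2 * r * lam) with hq
  have hp : p = 2 * r * lam * q := by rw [hq]; field_simp
  have hy : -Real.tanh q ∈ Set.Ioo (-1) 1 :=
    ⟨by linarith [Real.tanh_lt_one q], by linarith [Real.neg_one_lt_tanh q]⟩
  refine ⟨⟨by nlinarith [hy.2, hy.1], by nlinarith [hy.2, hy.1]⟩, fun u hu hne => ?_⟩
  obtain ⟨x, rfl⟩ : ∃ x, u = lam * x := ⟨u / lam, by field_simp⟩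
  have hx : x ∈ Set.Ioo (-1) 1 := ⟨by nlinarith [hu.1], by nlinarith [hu.2]⟩
  have hxy : x ≠ -Real.tanh q := fun h => hne (by rw [h]; ring)
  have key := mul_lt_mul_of_pos_left (normalized_penalty_tangent_lt hx hy hxy)
    (show 0 < lam ^ 2 * r by positivity)
  have hdiv (z : ℝ) : lam * z / lam = z := by field_simp
  have hsq (z : ℝ) : (lam * z) ^ 2 / lam ^ 2 = z ^ 2 := by field_simp
  rw [show -lam * Real.tanh q = lam * -Real.tanh q by ring, hdiv, hdiv, hsq, hsq, hp]
  rw [artanh_neg_tanh] at key ⊢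
  linear_combination key
end
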